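/- arXiv:2203.02537 — 3 statements merged into one kernel-verified Lean document; each statement's English description precedes it below -/
import Mathlib

section
/- Let G be a finite group with normal subgroups N ≤ M, primes p ≠ q, and P ∈ Syl_p(G), Q ∈ Syl_q(G) such that G = MP, M = NQ, and (G, P, P ∩ M) and (M, Q, Q ∩ N) are Frobenius-Wielandt triples. Then G is a {p,q}-group, i.e., |G| = p^a q^b for some nonnegative integers a, b. -/
open Subgroup

/-- `C` is a Frobenius complement in the ambient group: `1 < C < G` and
`C ∩ C^x = 1` for all `x ∉ C`. -/
def IsFrobeniusComplementIn {X : Type*} [Group X] (C : Subgroup X) : Prop :=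
  ⊥ < C ∧ C < ⊤ ∧ ∀ x : X, x ∉ C → C ⊓ C.map (MulAut.conj x).toMonoidHom = ⊥

/-- `X` is a Frobenius group. -/
def IsFrobeniusGroup (X : Type*) [Group X] : Prop :=
  ∃ C : Subgroup X, IsFrobeniusComplementIn C

/-- `K` is the Frobenius kernel of the ambient group: `K` is a proper nontrivial
normal subgroup admitting a Frobenius complement `C` with `X = K ⋊ C`. -/
def IsFrobeniusKernelIn {X : Type*} [Group X] (K : Subgroup X) : Prop :=
  K.Normal ∧ ⊥ < K ∧ K < ⊤ ∧ ∃ C : Subgroup X,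
    (∀ x : X, x ∉ C → C ⊓ C.map (MulAut.conj x).toMonoidHom = ⊥) ∧
    K ⊔ C = ⊤ ∧ K ⊓ C = ⊥

/-- `(X, H, L)` is a Frobenius–Wielandt triple: `L ⊴ H`, `L < H < X`, and
`H ∩ H^g ≤ L` for all `g ∉ H`. -/
def IsFWTriple {X : Type*} [Group X] (H L : Subgroup X) : Prop :=
  L ≤ H ∧ (L.subgroupOf H).Normal ∧ L < H ∧ H < ⊤ ∧
    ∀ g : X, g ∉ H → H ⊓ H.map (MulAut.conj g).toMonoidHom ≤ L

/-- `X` is a 2-Frobenius group: there are normal subgroups `K < L < X` with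
`X/K` a Frobenius group with kernel `L/K` and `L` a Frobenius group with kernel `K`. -/
def Is2FrobeniusGroup (X : Type*) [Group X] : Prop :=
  ∃ (K L : Subgroup X) (hK : K.Normal), L.Normal ∧ ⊥ < K ∧ K < L ∧ L < ⊤ ∧
    (@IsFrobeniusKernelIn _ (@QuotientGroup.Quotient.group X _ K hK)
      (L.map (@QuotientGroup.mk' X _ K hK))) ∧
    IsFrobeniusKernelIn (K.subgroupOf L)
lemma zpowers_pgroup {X : Type*} [Group X] {p : ℕ} (x : X) (a : ℕ) (ha : x ^ p ^ a = 1) :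
    IsPGroup p (zpowers x) := by
  rintro ⟨y, hy⟩
  obtain ⟨k, rfl⟩ := mem_zpowers_iff.1 hy
  refine ⟨a, ?_⟩
  apply Subtype.ext
  change (x ^ k) ^ p ^ a = 1
  rw [← zpow_natCast, ← zpow_mul, mul_comm, zpow_mul, zpow_natCast, ha, one_zpow]

lemma fw_centralizer {X : Type*} [Group X] [Finite X] {p : ℕ} [Fact p.Prime] (P : Sylow p X)
    (L K : Subgroup X) [K.Normal] (hL : L ≤ K)
    (h : ∀ g : X, g ∉ (P : Subgroup X) →
      (P : Subgroup X) ⊓ (P : Subgroup X).map (MulAut.conj g).toMonoidHom ≤ L)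
    (x c : X) (hx : ∃ a, x ^ p ^ a = 1) (hxK : x ∉ K) (hc : c * x = x * c) :
    ∃ a, c ^ p ^ a = 1 := by
  obtain ⟨a, ha⟩ := hx
  have hz : IsPGroup p (zpowers x) := zpowers_pgroup x a ha
  obtain ⟨S, hS⟩ := hz.exists_le_sylow
  obtain ⟨g, hg⟩ := MulAction.exists_smul_eq X P S
  have key : ∀ y, y ∈ (S : Subgroup X) ↔ g⁻¹ * y * g ∈ (P : Subgroup X) := by
    intro y
    rw [← hg, Sylow.coe_subgroup_smul, Subgroup.mem_pointwise_smul_iff_inv_smul_mem]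
    simp [MulAut.smul_def, ← map_inv]
  have hxS : g⁻¹ * x * g ∈ (P : Subgroup X) := (key x).1 (hS (mem_zpowers x))
  by_cases hd : g⁻¹ * c * g ∈ (P : Subgroup X)
  · obtain ⟨b, hb⟩ := P.isPGroup' ⟨_, hd⟩
    refine ⟨b, ?_⟩
    have h2 : (g⁻¹ * c * g) ^ p ^ b = 1 := by simpa using congrArg Subtype.val hb
    have h3 : g⁻¹ * c * g = g⁻¹ * c * (g⁻¹)⁻¹ := by simp
    rw [h3, conj_pow] at h2
    exact conj_eq_one_iff.1 h2
  · exfalso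
    have h1 : g⁻¹ * x * g ∈ L := by
      apply h _ hd
      refine ⟨hxS, ⟨_, hxS, ?_⟩⟩
      simp only [MulEquiv.coe_toMonoidHom, MulAut.conj_apply]
      have : c * x * c⁻¹ = x := by rw [hc]; group
      calc g⁻¹ * c * g * (g⁻¹ * x * g) * (g⁻¹ * c * g)⁻¹ = g⁻¹ * (c * x * c⁻¹) * g := by group
        _ = _ := by rw [this]
    have h2 := Normal.conj_mem ‹K.Normal› _ (hL h1) g
    apply hxK
    convert h2 using 1
    group

lemma exists_pelt {X : Type*} [Group X] [Finite X] {p : ℕ} [Fact p.Prime]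
    (K : Subgroup X) (x : X) (hx : x ∉ K) (k : ℕ) (hk : x ^ p ^ k ∈ K) :
    ∃ m : ℕ, x ^ m ∉ K ∧ ∃ a, (x ^ m) ^ p ^ a = 1 := by
  have hpos : orderOf x ≠ 0 := (orderOf_pos x).ne'
  obtain ⟨a, m, hm, he⟩ := Nat.exists_eq_pow_mul_and_not_dvd hpos p (Fact.out : p.Prime).ne_one
  refine ⟨m, ?_, a, ?_⟩
  · intro hmK
    apply hx
    have hco : IsCoprime ((p ^ k : ℕ) : ℤ) (m : ℤ) := by
      rw [Nat.isCoprime_iff_coprime]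
      exact Nat.Coprime.pow_left _ ((Nat.Prime.coprime_iff_not_dvd Fact.out).2 hm)
    obtain ⟨s, t, hst⟩ := hco
    have : x = (x ^ p ^ k) ^ s * (x ^ m) ^ t := by
      rw [← zpow_natCast, ← zpow_natCast, ← zpow_mul, ← zpow_mul, ← zpow_add, mul_comm _ s,
        mul_comm _ t, hst, zpow_one]
    rw [this]
    exact mul_mem (zpow_mem hk _) (zpow_mem hmK _)
  · rw [← pow_mul, mul_comm, ← he, pow_orderOf_eq_one]

lemma one_of_coprime_pow {X : Type*} [Group X] {x : X} {m n : ℕ} (h : Nat.Coprime m n)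
    (hm : x ^ m = 1) (hn : x ^ n = 1) : x = 1 := by
  rw [← orderOf_eq_one_iff]
  exact Nat.eq_one_of_dvd_coprimes h (orderOf_dvd_of_pow_eq_one hm) (orderOf_dvd_of_pow_eq_one hn)

lemma one_of_two_primes {X : Type*} [Group X] {x : X} {p q : ℕ} [Fact p.Prime] [Fact q.Prime]
    (hpq : p ≠ q) (hm : ∃ a, x ^ p ^ a = 1) (hn : ∃ a, x ^ q ^ a = 1) : x = 1 := by
  obtain ⟨a, ha⟩ := hm
  obtain ⟨b, hb⟩ := hn
  exact one_of_coprime_pow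
    (Nat.Coprime.pow a b ((Nat.coprime_primes Fact.out Fact.out).2 hpq)) ha hb

/-- If `x` has `p`-power in `K` and is a `q`-element then `x ∈ K`. -/
lemma mem_of_two_primes {X : Type*} [Group X] {x : X} {p q : ℕ} [Fact p.Prime] [Fact q.Prime]
    (hpq : p ≠ q) (K : Subgroup X) (hm : ∃ a, x ^ p ^ a ∈ K) (hn : ∃ a, x ^ q ^ a = 1) :
    x ∈ K := by
  obtain ⟨a, ha⟩ := hm
  obtain ⟨b, hb⟩ := hn
  have hco : IsCoprime ((p ^ a : ℕ) : ℤ) ((q ^ b : ℕ) : ℤ) := by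
    rw [Nat.isCoprime_iff_coprime]
    exact Nat.Coprime.pow a b ((Nat.coprime_primes Fact.out Fact.out).2 hpq)
  obtain ⟨s, t, hst⟩ := hco
  have : x = (x ^ p ^ a) ^ s * (x ^ q ^ b) ^ t := by
    rw [← zpow_natCast, ← zpow_natCast, ← zpow_mul, ← zpow_mul, ← zpow_add, mul_comm _ s,
      mul_comm _ t, hst, zpow_one]
  rw [this, hb, one_zpow, mul_one]
  exact zpow_mem ha _

lemma frob_action {A V : Type*} [Group A] [Finite A] [CommGroup V] (φ : A →* MulAut V)
    (U : Subgroup A) (x : A) (n : ℕ) (hn : 0 < n) (hxn : x ^ n = 1)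
    (hU : ∀ u ∈ U, x * u * x⁻¹ ∈ U)
    (hfree : ∀ i, 0 < i → i < n → ∀ u ∈ U, x ^ i * u = u * x ^ i → u = 1)
    (hx : ∀ v, φ x v = v → v = 1)
    (hUV : ∀ v, (∀ u ∈ U, φ u v = v) → v = 1) (v : V) : v ^ Nat.card U = 1 := by
  classical
  have : Fintype U := Fintype.ofFinite U
  have hpowU : ∀ i : ℕ, ∀ u ∈ U, x ^ i * u * (x ^ i)⁻¹ ∈ U := by
    intro i
    induction i with
    | zero => intro u hu; simpa using hu
    | succ i ih =>
      intro u hu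
      have := ih _ (hU u hu)
      rw [pow_succ]
      convert this using 1
      group
  have f1 : ∀ w, ∏ u : U, φ (u : A) w = 1 := by
    intro w
    apply hUV
    intro u hu
    rw [map_prod]
    refine Fintype.prod_equiv (Equiv.mulLeft (⟨u, hu⟩ : U)) _ _ ?_
    intro y
    simp
  have g1 : ∀ w, ∏ i ∈ Finset.range n, φ (x ^ i) w = 1 := by
    intro w
    apply hx
    rw [map_prod]
    have e : ∀ i, φ x (φ (x ^ i) w) = φ (x ^ (i + 1)) w := by
      intro i; rw [pow_succ', map_mul]; rfl
    simp only [e]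
    obtain ⟨k, rfl⟩ : ∃ k, n = k + 1 := ⟨n - 1, by omega⟩
    rw [Finset.prod_range_succ, Finset.prod_range_succ', hxn, pow_zero]
  have main : ∏ u : U, ∏ i ∈ Finset.range n, φ ((u : A) * x ^ i * (u : A)⁻¹) v = 1 := by
    apply Finset.prod_eq_one
    intro u _
    have := congrArg (φ (u : A)) (g1 (φ (u : A)⁻¹ v))
    rw [map_prod, map_one] at this
    simpa only [map_mul, MulAut.mul_apply] using this
  rw [Finset.prod_comm] at main
  rw [Finset.prod_eq_single 0] at main
  · simpa [Nat.card_eq_fintype_card] using main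
  · intro i hi hi0
    rw [Finset.mem_range] at hi
    rw [← f1 (φ (x ^ i) v)]
    let b : U → U := fun u => ⟨u * (x ^ i * (u : A)⁻¹ * (x ^ i)⁻¹),
      mul_mem u.2 (hpowU i _ (inv_mem u.2))⟩
    have hb : Function.Injective b := by
      intro s t hst
      have h1 : (s : A) * (x ^ i * (s : A)⁻¹ * (x ^ i)⁻¹) =
        t * (x ^ i * (t : A)⁻¹ * (x ^ i)⁻¹) := congrArg Subtype.val hst
      have h2 := hfree i (Nat.pos_of_ne_zero hi0) hi ((t : A)⁻¹ * s)
        (mul_mem (inv_mem t.2) s.2) (by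
          have h3 : (s : A) * x ^ i * (s : A)⁻¹ = t * x ^ i * (t : A)⁻¹ := by
            have := congrArg (· * x ^ i) h1
            simpa [mul_assoc] using this
          have h4 : (t : A)⁻¹ * (s * x ^ i * (s : A)⁻¹) * s =
            (t : A)⁻¹ * (t * x ^ i * (t : A)⁻¹) * s := by rw [h3]
          simpa [mul_assoc] using h4.symm)
      ext
      exact (inv_mul_eq_one.1 h2).symm
    refine Fintype.prod_bijective b (Finite.injective_iff_bijective.1 hb) _ _ ?_
    intro u
    have : (u : A) * x ^ i * (u : A)⁻¹ = (b u : A) * x ^ i := by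
      simp [b, mul_assoc]
    rw [this, map_mul]
    rfl
  · intro h; simp at h; omega

/-- The final contradiction, with all data inside `G`. -/
lemma core {G : Type*} [Group G] [Finite G] (N M V U : Subgroup G)
    [N.Normal] [M.Normal] (hNM : N ≤ M) {p q r : ℕ} [Fact p.Prime] [Fact q.Prime] [Fact r.Prime]
    (hpq : p ≠ q) (hrp : r ≠ p) (hrq : r ≠ q)
    (c1 : ∀ x c : G, (∃ a, x ^ p ^ a = 1) → x ∉ M → c * x = x * c → ∃ a, c ^ p ^ a = 1)
    (c2 : ∀ x c : G, (∃ a, x ^ q ^ a = 1) → x ∈ M → x ∉ N → c ∈ M → c * x = x * c →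
      ∃ a, c ^ q ^ a = 1)
    (hMN : ∀ x ∈ M, ∃ a, x ^ q ^ a ∈ N)
    (hVN : V ≤ N) (hVr : IsPGroup r V) (hVc : ∀ a ∈ V, ∀ b ∈ V, a * b = b * a)
    (hUV : U ≤ normalizer (V : Set G)) (hUq : IsPGroup q U) (hUM : U ≤ M)
    (u : G) (hu : u ∈ U) (huN : u ∉ N)
    (x : G) (hxp : ∃ a, x ^ p ^ a = 1) (hxM : x ∉ M) (hxV : x ∈ normalizer (V : Set G))
    (hxU : x ∈ normalizer (U : Set G)) : V = ⊥ := by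
  have hUe : ∀ y ∈ U, ∃ a, y ^ q ^ a = 1 := fun y hy => by
    obtain ⟨a, ha⟩ := hUq ⟨y, hy⟩
    exact ⟨a, by simpa using congrArg Subtype.val ha⟩
  have hVe : ∀ y ∈ V, ∃ a, y ^ r ^ a = 1 := fun y hy => by
    obtain ⟨a, ha⟩ := hVr ⟨y, hy⟩
    exact ⟨a, by simpa using congrArg Subtype.val ha⟩
  have hxpow : ∀ i : ℕ, ∃ a, (x ^ i) ^ p ^ a = 1 := fun i => by
    obtain ⟨a, ha⟩ := hxp
    exact ⟨a, by rw [← pow_mul, mul_comm, pow_mul, ha, one_pow]⟩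
  set n := orderOf (x : G ⧸ M) with hn
  have hn0 : 0 < n := orderOf_pos _
  have hlt : ∀ i, 0 < i → i < n → x ^ i ∉ M := by
    intro i h0 h1 hm
    apply pow_ne_one_of_lt_orderOf h0.ne' h1
    rw [← QuotientGroup.mk_pow]
    exact (QuotientGroup.eq_one_iff _).2 hm
  have hxnM : x ^ n ∈ M := by
    rw [← QuotientGroup.eq_one_iff, QuotientGroup.mk_pow, hn, pow_orderOf_eq_one]
  have hxnN : x ^ n ∈ N := mem_of_two_primes hpq.symm N (hMN _ hxnM) (hxpow n)
  have hnormU : ∀ g ∈ normalizer (U : Set G), ∀ y ∈ U, g * y * g⁻¹ ∈ U := fun g hg y hy =>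
    (mem_normalizer_iff.1 hg y).1 hy
  -- fixed point in the coset
  have hfix : ∃ w ∈ U, w ∉ N ∧ x ^ n * w = w * x ^ n := by
    have hzp : IsPGroup p (zpowers (x ^ n)) := by
      obtain ⟨a, ha⟩ := hxpow n
      exact zpowers_pgroup _ a ha
    have hzU : zpowers (x ^ n) ≤ normalizer (U : Set G) := by
      rw [zpowers_le]; exact pow_mem hxU n
    have hzN : zpowers (x ^ n) ≤ N := by
      rw [zpowers_le]; exact hxnN
    let α := {w : G // w ∈ U ∧ w * u⁻¹ ∈ N}
    let e : α ≃ (U ⊓ N : Subgroup G) :=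
      { toFun := fun w => ⟨w * u⁻¹, U.mul_mem w.2.1 (U.inv_mem hu), w.2.2⟩
        invFun := fun t => ⟨t * u, U.mul_mem t.2.1 hu, by simpa using t.2.2⟩
        left_inv := fun w => by simp
        right_inv := fun t => by simp }
    have hcard : ¬ p ∣ Nat.card α := by
      rw [Nat.card_congr e]
      obtain ⟨k, hk⟩ := IsPGroup.iff_card.1 (hUq.to_le (inf_le_left : U ⊓ N ≤ U))
      rw [hk]
      intro hd
      exact hpq ((Nat.prime_dvd_prime_iff_eq Fact.out Fact.out).1
        (Nat.Prime.dvd_of_dvd_pow Fact.out hd))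
    let act : MulAction (zpowers (x ^ n)) α :=
      { smul := fun z w => ⟨z * w * (z : G)⁻¹, hnormU _ (hzU z.2) _ w.2.1, by
          have h1 : (w : G) * (z : G)⁻¹ * (w : G)⁻¹ ∈ N :=
            Normal.conj_mem inferInstance _ (inv_mem (hzN z.2)) _
          have h2 := mul_mem (mul_mem (hzN z.2) h1) w.2.2
          convert h2 using 1
          group⟩
        one_smul := fun w => by
          apply Subtype.ext
          change ((1 : zpowers (x ^ n)) : G) * w * ((1 : zpowers (x ^ n)) : G)⁻¹ = w
          simp
        mul_smul := fun y z w => by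
          apply Subtype.ext
          change ((y * z : zpowers (x ^ n)) : G) * w * ((y * z : zpowers (x ^ n)) : G)⁻¹ =
            y * (z * w * (z : G)⁻¹) * (y : G)⁻¹
          simp [mul_assoc] }
    obtain ⟨w, hw⟩ := hzp.nonempty_fixed_point_of_prime_not_dvd_card α hcard
    refine ⟨w, w.2.1, ?_, ?_⟩
    · intro hwN
      apply huN
      have := mul_mem (inv_mem w.2.2) hwN
      simpa using this
    · have h1 : x ^ n * w * (x ^ n)⁻¹ = w :=
        congrArg Subtype.val (hw ⟨x ^ n, mem_zpowers _⟩)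
      exact mul_inv_eq_iff_eq_mul.1 h1
  have hxn : x ^ n = 1 := by
    obtain ⟨w, hwU, hwN, hw⟩ := hfix
    exact one_of_two_primes hpq (hxpow n) (c2 w _ (hUe w hwU) (hUM hwU) hwN hxnM hw)
  -- apply the averaging lemma
  let _ : CommGroup V := { (inferInstance : Group V) with
    mul_comm := fun a b => Subtype.ext (hVc a a.2 b b.2) }
  have hact : ∀ (g : normalizer (V : Set G)) (v : V), V.normalizerMonoidHom g v = v →
      (v : G) * g = g * v := by
    intro g v h
    have h1 : (g : G) * v * (g : G)⁻¹ = v := congrArg Subtype.val h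
    exact (mul_inv_eq_iff_eq_mul.1 h1).symm
  have key := frob_action (V.normalizerMonoidHom) (U.subgroupOf (normalizer (V : Set G)))
    ⟨x, hxV⟩ n hn0 (Subtype.ext hxn)
    (fun y hy => hnormU x hxU _ hy)
    (fun i h0 h1 y hy he => by
      apply Subtype.ext
      have he' : x ^ i * (y : G) = y * x ^ i := congrArg Subtype.val he
      exact one_of_two_primes hpq (c1 (x ^ i) y (hxpow i) (hlt i h0 h1) he'.symm) (hUe _ hy))
    (fun v hv => by
      apply Subtype.ext
      exact one_of_two_primes hrp (hVe _ v.2) (c1 x v hxp hxM (hact _ _ hv)))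
    (fun v hv => by
      apply Subtype.ext
      exact one_of_two_primes hrq (hVe _ v.2) (c2 u v (hUe u hu) (hUM hu) huN (hNM (hVN v.2))
        (hact ⟨u, hUV hu⟩ v (hv _ hu))))
  rw [eq_bot_iff]
  intro v hv
  obtain ⟨b, hb⟩ := IsPGroup.iff_card.1 hUq
  have h1 := key ⟨v, hv⟩
  rw [Nat.card_congr (subgroupOfEquivOfLe hUV).toEquiv, hb] at h1
  exact one_of_two_primes hrq (hVe v hv) ⟨b, congrArg Subtype.val h1⟩

lemma quot_pow {G : Type*} [Group G] {p : ℕ} [Fact p.Prime] (M P T : Subgroup G) [M.Normal]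
    (hP : IsPGroup p P) (h : M ⊔ P = T) (x : G) (hx : x ∈ T) : ∃ a, x ^ p ^ a ∈ M := by
  rw [← h, ← SetLike.mem_coe, normal_mul] at hx
  obtain ⟨m, hm, y, hy, rfl⟩ := hx
  obtain ⟨a, ha⟩ := hP ⟨y, hy⟩
  have ha' : y ^ p ^ a = 1 := congrArg Subtype.val ha
  refine ⟨a, ?_⟩
  rw [← QuotientGroup.eq_one_iff, QuotientGroup.mk_pow, QuotientGroup.mk_mul,
    (QuotientGroup.eq_one_iff m).2 hm, one_mul, ← QuotientGroup.mk_pow, ha']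
  rfl

lemma frat {G : Type*} [Group G] (N H M : Subgroup G) [N.Normal] (h : H ⊔ N = ⊤)
    (hNM : N ≤ M) (g : G) (hg : g ∉ M) : ∃ y ∈ H, y ∉ M ∧ ∃ n ∈ N, g = y * n := by
  have : g ∈ ((H ⊔ N : Subgroup G) : Set G) := by rw [h]; trivial
  rw [mul_normal] at this
  obtain ⟨y, hy, n, hn, rfl⟩ := this
  exact ⟨y, hy, fun hM => hg (mul_mem hM (hNM hn)), n, hn, rfl⟩

lemma no_third_prime {G : Type*} [Group G] [Finite G] (N M : Subgroup G)
    [N.Normal] [M.Normal] (hNM : N ≤ M)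
    {p q r : ℕ} [Fact p.Prime] [Fact q.Prime] [Fact r.Prime] (hpq : p ≠ q)
    (hrp : r ≠ p) (hrq : r ≠ q)
    (P : Sylow p G) (Q : Sylow q G)
    (hG : M ⊔ (P : Subgroup G) = ⊤) (hM : N ⊔ (Q : Subgroup G) = M)
    (h1 : IsFWTriple (P : Subgroup G) ((P : Subgroup G) ⊓ M))
    (h2 : IsFWTriple ((Q : Subgroup G).subgroupOf M)
      (((Q : Subgroup G) ⊓ N).subgroupOf M)) : ¬ r ∣ Nat.card G := by
  intro hr
  have hGM : ∀ x : G, ∃ a, x ^ p ^ a ∈ M := fun x => quot_pow M P ⊤ P.isPGroup' hG x trivial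
  have hMN : ∀ x ∈ M, ∃ a, x ^ q ^ a ∈ N := quot_pow N Q M Q.isPGroup' hM
  have hQM : (Q : Subgroup G) ≤ M := hM ▸ le_sup_right
  have c1 : ∀ x c : G, (∃ a, x ^ p ^ a = 1) → x ∉ M → c * x = x * c → ∃ a, c ^ p ^ a = 1 :=
    fun x c hx hxM hc => fw_centralizer P _ M inf_le_right h1.2.2.2.2 x c hx hxM hc
  have c2 : ∀ x c : G, (∃ a, x ^ q ^ a = 1) → x ∈ M → x ∉ N → c ∈ M → c * x = x * c →
      ∃ a, c ^ q ^ a = 1 := by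
    intro x c ⟨a, hx⟩ hxM hxN hcM hc
    obtain ⟨b, hb⟩ := fw_centralizer (Q.subtype hQM) (((Q : Subgroup G) ⊓ N).subgroupOf M)
      (N.subgroupOf M)
      (fun y hy => (mem_subgroupOf.1 hy).2) h2.2.2.2.2 ⟨x, hxM⟩ ⟨c, hcM⟩ ⟨a, Subtype.ext hx⟩ hxN (Subtype.ext hc)
    exact ⟨b, congrArg Subtype.val hb⟩
  obtain ⟨g, hgP, hgM⟩ : ∃ g ∈ (P : Subgroup G), g ∉ M := by
    obtain ⟨g, hg, hg'⟩ := SetLike.exists_of_lt h1.2.2.1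
    exact ⟨g, hg, fun h => hg' ⟨hg, h⟩⟩
  obtain ⟨u₀, hu₀Q, hu₀N⟩ : ∃ g ∈ (Q : Subgroup G), g ∉ N := by
    obtain ⟨g, hg, hg'⟩ := SetLike.exists_of_lt h2.2.2.1
    exact ⟨g, hg, fun h => hg' ⟨hg, h⟩⟩
  let R : Sylow r G := default
  have hRe : ∀ y ∈ (R : Subgroup G), ∃ a, y ^ r ^ a = 1 := fun y hy => by
    obtain ⟨a, ha⟩ := R.isPGroup' ⟨y, hy⟩
    exact ⟨a, congrArg Subtype.val ha⟩
  have hRN : (R : Subgroup G) ≤ N := fun y hy =>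
    mem_of_two_primes hrq.symm N (hMN y (mem_of_two_primes hrp.symm M (hGM y) (hRe y hy)))
      (hRe y hy)
  have hR1 : Nontrivial (R : Subgroup G) := by
    rw [Subgroup.nontrivial_iff_ne_bot]
    exact R.ne_bot_of_dvd_card hr
  have F1 := Sylow.normalizer_sup_eq_top' R hRN
  set H : Subgroup G := normalizer ((R : Subgroup G) : Set G) with hH
  -- a `q`-element of `H` outside `N`
  obtain ⟨h, hhH, hhN, n, hn, hhn⟩ := frat N H N F1 le_rfl u₀ hu₀N
  have hhM : h ∈ M := by
    have : h = u₀ * n⁻¹ := by rw [hhn]; group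
    rw [this]; exact mul_mem (hQM hu₀Q) (inv_mem (hNM hn))
  obtain ⟨k, hk⟩ := hMN h hhM
  obtain ⟨m, hmN, a, ha⟩ := exists_pelt N h hhN k hk
  have huH : h ^ m ∈ H := pow_mem hhH m
  set u := h ^ m with hu
  have hz : IsPGroup q (zpowers (⟨u, huH⟩ : H)) :=
    zpowers_pgroup _ a (Subtype.ext ha)
  obtain ⟨Q1, hQ1⟩ := hz.exists_le_sylow
  have hQ1e : ∀ y ∈ (Q1 : Subgroup H), ∃ a, (y : G) ^ q ^ a = 1 := fun y hy => by
    obtain ⟨a, ha⟩ := Q1.isPGroup' ⟨y, hy⟩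
    exact ⟨a, congrArg (fun z : (Q1 : Subgroup H) => ((z : H) : G)) ha⟩
  have hQ1M : (Q1 : Subgroup H) ≤ M.subgroupOf H := fun y hy =>
    mem_of_two_primes hpq M (hGM y) (hQ1e y hy)
  have F2 := Sylow.normalizer_sup_eq_top' Q1 hQ1M
  obtain ⟨y, hyH, hyM, -⟩ := frat N H M F1 hNM g hgM
  obtain ⟨y', hy', hy'M, -⟩ := frat (M.subgroupOf H) _ (M.subgroupOf H) F2 le_rfl ⟨y, hyH⟩ hyM
  obtain ⟨k', hk'⟩ := hGM y'
  obtain ⟨m', hm'M, a', ha'⟩ := exists_pelt M (y' : G) hy'M k' hk'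
  let V : Subgroup G := (center (R : Subgroup G)).map (R : Subgroup G).subtype
  have hVR : V ≤ R := map_subtype_le _
  have hHV : H ≤ normalizer (V : Set G) := by
    have hm : ∀ v, v ∈ V ↔ v ∈ (R : Subgroup G) ∧ ∀ t ∈ (R : Subgroup G), t * v = v * t := by
      intro v
      constructor
      · rintro ⟨w, hw, rfl⟩
        refine ⟨w.2, fun t ht => ?_⟩
        exact congrArg Subtype.val (mem_center_iff.1 hw ⟨t, ht⟩)
      · rintro ⟨hv, hc⟩
        exact ⟨⟨v, hv⟩, mem_center_iff.2 fun t => Subtype.ext (hc t t.2), rfl⟩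
    have step : ∀ z ∈ H, ∀ v ∈ V, z * v * z⁻¹ ∈ V := by
      intro z hz v hv
      rw [hm] at hv ⊢
      refine ⟨(mem_normalizer_iff.1 hz v).1 hv.1, fun t ht => ?_⟩
      have h3 : z⁻¹ * t * z ∈ (R : Subgroup G) := by
        have := (mem_normalizer_iff.1 (inv_mem hz) t).1 ht
        simpa using this
      have h4 := hv.2 _ h3
      have h5 : z * (z⁻¹ * t * z * v) * z⁻¹ = z * (v * (z⁻¹ * t * z)) * z⁻¹ := by rw [h4]
      simpa [mul_assoc] using h5
    intro z hz
    rw [mem_normalizer_iff]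
    intro v
    refine ⟨step z hz v, fun hv => ?_⟩
    have := step z⁻¹ (inv_mem hz) _ hv
    simpa [mul_assoc] using this
  have hVbot : V = ⊥ := by
    refine core N M V ((Q1 : Subgroup H).map H.subtype) hNM hpq hrp hrq c1 c2 hMN
      (hVR.trans hRN) (R.isPGroup'.to_le hVR) ?_ ((map_subtype_le _).trans hHV)
      (Q1.isPGroup'.map _) ?_ u ⟨⟨u, huH⟩, hQ1 (mem_zpowers _), rfl⟩ hmN
      ((y' : G) ^ m') ⟨a', ha'⟩ hm'M (hHV (pow_mem y'.2 m')) ?_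
    · rintro _ ⟨b, hb, rfl⟩ _ ⟨c, hc, rfl⟩
      exact congrArg Subtype.val (mem_center_iff.1 hc b)
    · rintro _ ⟨b, hb, rfl⟩
      exact hQ1M hb
    · apply pow_mem
      exact le_normalizer_map H.subtype ⟨y', hy', rfl⟩
  have : Nontrivial (center (R : Subgroup G)) := R.isPGroup'.center_nontrivial
  rw [Subgroup.nontrivial_iff_ne_bot] at this
  exact this ((map_eq_bot_iff_of_injective _ (subtype_injective _)).1 hVbot)

theorem stmt_9 {G : Type*} [Group G] [Fintype G] (N M : Subgroup G)
    [N.Normal] [M.Normal] (hNM : N ≤ M)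
    {p q : ℕ} [Fact p.Prime] [Fact q.Prime] (hpq : p ≠ q)
    (P : Sylow p G) (Q : Sylow q G)
    (hG : M ⊔ (P : Subgroup G) = ⊤) (hM : N ⊔ (Q : Subgroup G) = M)
    (h1 : IsFWTriple (P : Subgroup G) ((P : Subgroup G) ⊓ M))
    (h2 : IsFWTriple ((Q : Subgroup G).subgroupOf M)
      (((Q : Subgroup G) ⊓ N).subgroupOf M)) :
    ∃ a b : ℕ, Fintype.card G = p ^ a * q ^ b := by
  have h0 : Fintype.card G ≠ 0 := Fintype.card_ne_zero
  obtain ⟨a, m, hm, he⟩ := Nat.exists_eq_pow_mul_and_not_dvd h0 p (Fact.out : p.Prime).ne_one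
  have hm0 : m ≠ 0 := by rintro rfl; simp at hm
  obtain ⟨b, k, hk, he'⟩ := Nat.exists_eq_pow_mul_and_not_dvd hm0 q (Fact.out : q.Prime).ne_one
  refine ⟨a, b, ?_⟩
  have hk1 : k = 1 := by
    by_contra hne
    obtain ⟨r, hr, hrk⟩ := Nat.exists_prime_and_dvd hne
    have : Fact r.Prime := ⟨hr⟩
    have hrm : r ∣ m := he' ▸ Dvd.dvd.mul_left hrk _
    refine no_third_prime N M hNM (r := r) hpq ?_ ?_ P Q hG hM h1 h2 ?_
    · rintro rfl; exact hm hrm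
    · rintro rfl; exact hk hrk
    · rw [Nat.card_eq_fintype_card, he]
      exact Dvd.dvd.mul_left hrm _
  rw [he, he', hk1, mul_one]
end

section
/- Let G be a finite group with a normal subgroup N such that G/N is not solvable. Then every element of G \ N has prime power order if and only if every element of G has prime power order. -/
open Subgroup

universe u

lemma aux_pow_comm {T : Type*} [Group T] (x y c : T) (hc : ∀ g, c * g = g * c)
    (h : y * x = x * y * c) (n : ℕ) : y ^ n * x = x * y ^ n * c ^ n := by
  induction n with
  | zero => simp
  | succ n ih =>
    have hcn : ∀ g, c ^ n * g = g * c ^ n := fun g => (show Commute c g from hc g).pow_left n |>.eq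
    calc y ^ (n+1) * x = y ^ n * (y * x) := by rw [pow_succ]; group
      _ = (y ^ n * x) * y * c := by rw [h]; group
      _ = x * y ^ n * (c ^ n * y) * c := by rw [ih]; group
      _ = x * y ^ (n+1) * c ^ (n+1) := by rw [hcn, pow_succ, pow_succ]; group

lemma aux_pow_mul {T : Type*} [Group T] (x y c : T) (hc : ∀ g, c * g = g * c)
    (h : y * x = x * y * c) (n : ℕ) : (x * y) ^ n = x ^ n * y ^ n * c ^ (n.choose 2) := by
  induction n with
  | zero => simp
  | succ n ih =>
    have hcn : ∀ m g, c ^ m * g = g * c ^ m := fun m g => (show Commute c g from hc g).pow_left m |>.eq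
    have e : (n+1).choose 2 = n + n.choose 2 := by
      rw [Nat.choose_succ_succ' n 1]; simp
    calc (x * y) ^ (n+1) = x ^ n * y ^ n * (c ^ (n.choose 2) * (x * y)) := by
          rw [pow_succ, ih]; group
      _ = x ^ n * (y ^ n * x) * y * c ^ (n.choose 2) := by rw [hcn]; group
      _ = x ^ n * x * y ^ n * (c ^ n * y) * c ^ (n.choose 2) := by
          rw [aux_pow_comm x y c hc h]; group
      _ = x ^ (n+1) * y ^ (n+1) * c ^ ((n+1).choose 2) := by
          rw [hcn, e, pow_add, pow_succ, pow_succ]; group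

lemma aux_coatom_index {T : Type*} [Group T] [Finite T] (q : ℕ) [hq : Fact q.Prime]
    (hT : IsPGroup q T) (M : Subgroup T) (hM : IsCoatom M) : M.index = q := by
  obtain ⟨n, hn⟩ := IsPGroup.iff_card.mp hT
  obtain ⟨k, hk⟩ := IsPGroup.iff_card.mp (hT.to_subgroup M)
  have hlt : Nat.card M < Nat.card T := by
    refine lt_of_le_of_ne (Subgroup.card_le_card_group M) fun h => hM.1 ?_
    exact Subgroup.eq_top_of_card_eq M h
  have hkn : k + 1 ≤ n := by
    rw [hk, hn] at hlt
    exact (Nat.pow_lt_pow_iff_right hq.out.one_lt).mp hlt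
  obtain ⟨K, hK, hMK⟩ := Sylow.exists_subgroup_card_pow_succ (p := q) (n := k)
    (by rw [hn]; exact pow_dvd_pow q hkn) hk
  have hKtop : K = ⊤ := by
    refine hM.2 K (lt_of_le_of_ne hMK fun h => ?_)
    rw [← h, hk] at hK
    have := Nat.pow_right_injective hq.out.two_le hK
    omega
  have h1 := M.card_mul_index
  rw [hKtop, Subgroup.card_top] at hK
  rw [hK, hk, pow_succ] at h1
  exact Nat.eq_of_mul_eq_mul_left (pow_pos hq.out.pos k) h1

lemma aux_comm_mem {T : Type*} [Group T] [Finite T] (q : ℕ) [hq : Fact q.Prime]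
    (M : Subgroup T) [M.Normal] (hM : M.index = q) (x y : T) : (x * y)⁻¹ * (y * x) ∈ M := by
  rw [← QuotientGroup.eq]
  have : Nat.card (T ⧸ M) = q := hM
  have := isCyclic_of_prime_card this
  let _ := IsCyclic.commGroup (α := T ⧸ M)
  exact mul_comm (x : T ⧸ M) (y : T ⧸ M)

theorem aux_cyclic (q : ℕ) [hq : Fact q.Prime] (hq2 : q ≠ 2) : ∀ (n : ℕ) (T : Type u) [Group T]
    [Finite T], Nat.card T = n → IsPGroup q T → Nat.card {x : T // x ^ q = 1} ≤ q →
    IsCyclic T := by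
  intro n
  induction n using Nat.strong_induction_on with
  | _ n ih =>
  intro T _ _ hn hT hcard
  by_contra hcyc
  have hsub : ∀ M : Subgroup T, M ≠ ⊤ → IsCyclic M := by
    intro M hM
    refine ih (Nat.card M) ?_ M rfl (hT.to_subgroup M) ?_
    · rw [← hn]
      exact lt_of_le_of_ne (Subgroup.card_le_card_group M)
        fun h => hM (Subgroup.eq_top_of_card_eq M h)
    · refine le_trans ?_ hcard
      refine Nat.card_le_card_of_injective
        (fun x : {x : M // x ^ q = 1} => (⟨x.1.1, by
          have := congrArg Subtype.val x.2
          simpa using this⟩ : {x : T // x ^ q = 1})) ?_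
      intro a b hab
      simp only [Subtype.mk.injEq] at hab
      exact Subtype.ext (Subtype.ext hab)
  have : Nontrivial T := by
    by_contra h
    rw [not_nontrivial_iff_subsingleton] at h
    exact hcyc inferInstance
  have : Group.IsNilpotent T := hT.isNilpotent
  obtain ⟨M1, hM1, -⟩ := (eq_top_or_exists_le_coatom (⊥ : Subgroup T)).resolve_left bot_ne_top
  obtain ⟨y, hy⟩ : ∃ y, y ∉ M1 := by
    by_contra! h
    exact hM1.1 (Subgroup.eq_top_iff' _ |>.mpr h)
  have hyt : zpowers y ≠ ⊤ := fun h => hcyc ⟨y, fun g => by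
    have hg : g ∈ zpowers y := by rw [h]; trivial
    exact hg⟩
  obtain ⟨M2, hM2, hyM⟩ := (eq_top_or_exists_le_coatom (zpowers y)).resolve_left hyt
  have hne : ¬ M1 ≤ M2 := by
    intro h
    rcases hM1.le_iff.mp h with h' | h'
    · exact hM2.1 h'
    · exact hy (h' ▸ hyM (mem_zpowers y))
  have hn1 : M1.Normal := NormalizerCondition.normal_of_coatom _
    (Group.normalizerCondition_of_isNilpotent) hM1
  have hn2 : M2.Normal := NormalizerCondition.normal_of_coatom _
    (Group.normalizerCondition_of_isNilpotent) hM2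
  have hi1 := aux_coatom_index q hT M1 hM1
  have hi2 := aux_coatom_index q hT M2 hM2
  have hc1 := hsub M1 hM1.1
  have hc2 := hsub M2 hM2.1
  have hab : ∀ M : Subgroup T, IsCyclic M → ∀ a ∈ M, ∀ b ∈ M, a * b = b * a := by
    intro M hM a ha b hb
    let _ := IsCyclic.commGroup (α := M)
    have := mul_comm (⟨a, ha⟩ : M) ⟨b, hb⟩
    exact congrArg Subtype.val this
  have hsup : M1 ⊔ M2 = ⊤ := by
    refine hM2.2 _ (lt_of_le_of_ne le_sup_right fun h => hne ?_)
    rw [h]; exact le_sup_left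
  have hcen : ∀ c ∈ M1 ⊓ M2, ∀ g, c * g = g * c := by
    intro c hc g
    have : M1 ⊔ M2 ≤ centralizer {c} := by
      refine sup_le ?_ ?_
      · intro g hg
        rw [mem_centralizer_singleton_iff]
        exact hab M1 hc1 _ hg _ hc.1
      · intro g hg
        rw [mem_centralizer_singleton_iff]
        exact hab M2 hc2 _ hg _ hc.2
    have hg : g ∈ centralizer {c} := this (by rw [hsup]; trivial)
    rw [mem_centralizer_singleton_iff] at hg
    exact hg.symm
  have hpm : ∀ x : T, x ^ q ∈ M1 ⊓ M2 := fun x =>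
    ⟨by have := M1.pow_index_mem x; rwa [hi1] at this,
     by have := M2.pow_index_mem x; rwa [hi2] at this⟩
  have hmul : ∀ x y : T, (x * y) ^ q = x ^ q * y ^ q := by
    intro x y
    set c := (x * y)⁻¹ * (y * x) with hc
    have hcm : c ∈ M1 ⊓ M2 := ⟨aux_comm_mem q M1 hi1 x y, aux_comm_mem q M2 hi2 x y⟩
    have hyx : y * x = x * y * c := by rw [hc]; group
    have hcq : c ^ q = 1 := by
      have h1 := aux_pow_comm x y c (hcen c hcm) hyx q
      have h2 := hcen _ (hpm y) x
      rw [h2] at h1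
      exact (left_eq_mul.mp h1)
    rw [aux_pow_mul x y c (hcen c hcm) hyx q]
    obtain ⟨k, hk⟩ : q ∣ q.choose 2 := hq.out.dvd_choose_self (by norm_num)
      (lt_of_le_of_ne hq.out.two_le (Ne.symm hq2))
    rw [hk, pow_mul, hcq, one_pow, mul_one]
  let f : T →* T := { toFun := fun x => x ^ q, map_one' := one_pow q, map_mul' := hmul }
  have hk : Nat.card f.ker ≤ q := hcard
  have hr : Nat.card f.range ≤ Nat.card (M1 ⊓ M2 : Subgroup T) := by
    apply Nat.card_le_card_of_injective (Subgroup.inclusion ?_) (Subgroup.inclusion_injective _)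
    rintro _ ⟨x, rfl⟩
    exact hpm x
  have h1 : Nat.card f.ker * Nat.card f.range = Nat.card T := by
    rw [← f.ker.card_mul_index, Subgroup.index_ker]
  have h2 := (M1 ⊓ M2).card_mul_index
  have h3 : (M1 ⊓ M2).relIndex M1 * M1.index = (M1 ⊓ M2).index :=
    Subgroup.relIndex_mul_index inf_le_left
  have h4 : q ∣ (M1 ⊓ M2).relIndex M1 := by
    obtain ⟨k, hk⟩ := (hT.to_subgroup M1).index ((M1 ⊓ M2).subgroupOf M1)
    change (M1 ⊓ M2).relIndex M1 = _ at hk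
    rcases k with _ | k
    · rw [pow_zero, Subgroup.relIndex_eq_one] at hk
      exact absurd (hk.trans inf_le_right) hne
    · rw [hk]; exact dvd_pow_self q (by omega)
  have hpos : 0 < Nat.card (M1 ⊓ M2 : Subgroup T) := Nat.card_pos
  have h5 : q ≤ (M1 ⊓ M2).relIndex M1 := by
    refine Nat.le_of_dvd (Nat.pos_of_ne_zero fun h => ?_) h4
    rw [h, zero_mul] at h3
    rw [← h3, mul_zero] at h2
    exact (Nat.card_pos (α := T)).ne h2
  rw [hi1] at h3
  have hq1 := hq.out.two_le
  have h6 : q * q ≤ (M1 ⊓ M2).index := by rw [← h3]; gcongr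
  have h7 : Nat.card T ≤ q * Nat.card (M1 ⊓ M2 : Subgroup T) := by rw [← h1]; gcongr
  have h8 : Nat.card (M1 ⊓ M2 : Subgroup T) * (q * q) ≤ Nat.card T := by rw [← h2]; gcongr
  nlinarith

lemma aux_prod_fixed {A : Type*} [CommGroup A] {T : Type*} [Group T] (φ : T →* MulAut A) (q : ℕ)
    (g : T) (hg : g ^ q = 1) (hfix : ∀ a, φ g a = a → a = 1) (a : A) :
    ∏ i ∈ Finset.range q, φ (g ^ i) a = 1 := by
  apply hfix
  rw [map_prod]
  have h1 := Finset.prod_range_succ' (fun i => φ (g ^ i) a) q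
  have h2 := Finset.prod_range_succ (fun i => φ (g ^ i) a) q
  rw [h1] at h2
  simp only [hg, pow_zero, map_one, MulAut.one_apply] at h2
  have h3 := mul_right_cancel h2
  rw [← h3]
  refine Finset.prod_congr rfl fun i _ => ?_
  rw [pow_succ', map_mul, MulAut.mul_apply]

lemma aux_rank2 {A : Type*} [CommGroup A] {T : Type*} [Group T] (φ : T →* MulAut A) (q : ℕ)
    [hq : Fact q.Prime] (hf : ∀ g : T, g ^ q = 1 → g ≠ 1 → ∀ a, φ g a = a → a = 1)
    (x z : T) (hc : Commute x z) (hx : x ^ q = 1) (hz : z ^ q = 1) (hz1 : z ≠ 1)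
    (hxz : x ∉ zpowers z) (a : A) : a ^ q = 1 := by
  have hoz : orderOf z = q := orderOf_eq_prime hz hz1
  have key : ∏ j ∈ Finset.range q, ∏ i ∈ Finset.range q, φ ((x * z ^ j) ^ i) a = 1 := by
    refine Finset.prod_eq_one fun j _ => ?_
    have h1 : (x * z ^ j) ^ q = 1 := by
      rw [(hc.pow_right j).mul_pow, hx, one_mul, ← pow_mul, mul_comm, pow_mul, hz, one_pow]
    refine aux_prod_fixed φ q _ h1 (hf _ h1 fun h => hxz ?_) a
    rw [mul_eq_one_iff_eq_inv] at h
    rw [h]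
    exact inv_mem (pow_mem (mem_zpowers z) j)
  rw [Finset.prod_comm] at key
  rw [Finset.prod_eq_single 0] at key
  · simpa using key
  · intro i hi hi0
    have hzi : z ^ i ≠ 1 := by
      intro h
      have := orderOf_dvd_of_pow_eq_one h
      rw [hoz] at this
      exact absurd (Nat.le_of_dvd (Nat.pos_of_ne_zero hi0) this)
        (not_le.mpr (Finset.mem_range.mp hi))
    have hziq : (z ^ i) ^ q = 1 := by rw [← pow_mul, mul_comm, pow_mul, hz, one_pow]
    have h2 := aux_prod_fixed φ q (z ^ i) hziq (hf _ hziq hzi) a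
    have h3 : ∀ j, φ ((x * z ^ j) ^ i) a = φ (x ^ i) (φ ((z ^ i) ^ j) a) := by
      intro j
      rw [(hc.pow_right j).mul_pow, map_mul, MulAut.mul_apply, ← pow_mul, ← pow_mul, mul_comm j i]
    simp only [h3]
    rw [← map_prod, h2, map_one]
  · intro h
    exact absurd (Finset.mem_range.mpr hq.out.pos) h

theorem aux_cyclic_act {A : Type*} [CommGroup A] [Nontrivial A] {T : Type u} [Group T] [Finite T]
    (φ : T →* MulAut A) (p q : ℕ) [hp : Fact p.Prime] [hq : Fact q.Prime] (hpq : p ≠ q)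
    (hq2 : q ≠ 2) (hA : IsPGroup p A) (hT : IsPGroup q T)
    (hf : ∀ g : T, g ^ q = 1 → g ≠ 1 → ∀ a, φ g a = a → a = 1) : IsCyclic T := by
  rcases subsingleton_or_nontrivial T with h | h
  · infer_instance
  obtain ⟨a, ha⟩ := exists_ne (1 : A)
  have := hT.center_nontrivial
  have hd : q ∣ Nat.card (center T) := (hT.to_subgroup _).card_eq_or_dvd.resolve_left
    (by rw [← ne_eq]; exact (Finite.one_lt_card).ne')
  obtain ⟨z, hz⟩ := exists_prime_orderOf_dvd_card' (G := center T) q hd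
  have hzo : orderOf (z : T) = q := by rw [Subgroup.orderOf_coe, hz]
  have hz1 : (z : T) ≠ 1 := by
    intro h
    rw [h, orderOf_one] at hzo
    exact hq.out.one_lt.ne hzo
  refine aux_cyclic q hq2 _ T rfl hT ?_
  have hsub : ∀ x : T, x ^ q = 1 → x ∈ zpowers (z : T) := by
    intro x hx
    by_contra hxz
    have h1 := aux_rank2 φ q hf x z ((Subgroup.mem_center_iff.mp z.2 x))
      hx (by rw [← hzo]; exact pow_orderOf_eq_one _) hz1 hxz a
    obtain ⟨k, hk⟩ := IsPGroup.iff_orderOf.mp hA a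
    have h2 := orderOf_dvd_of_pow_eq_one h1
    rw [hk] at h2
    have hk0 : k ≠ 0 := by
      rintro rfl
      exact ha (orderOf_eq_one_iff.mp (by simpa using hk))
    exact hpq ((Nat.prime_dvd_prime_iff_eq hp.out hq.out).mp ((dvd_pow_self p hk0).trans h2))
  calc Nat.card {x : T // x ^ q = 1} ≤ Nat.card (zpowers (z : T)) :=
        Nat.card_le_card_of_injective (fun x => (⟨x.1, hsub x.1 x.2⟩ : zpowers (z : T)))
          (fun a b hab => Subtype.ext (congrArg (fun t => t.1) hab))
    _ = q := by rw [Nat.card_zpowers, hzo]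

def PPOrd (n : ℕ) : Prop := ∃ r k : ℕ, r.Prime ∧ n = r ^ k

def HypE {G Q : Type*} [Group G] [Group Q] (f : G →* Q) : Prop :=
  ∀ g, f g ≠ 1 → PPOrd (orderOf g)

lemma PPOrd.of_dvd {m n : ℕ} (hn : PPOrd n) (h : m ∣ n) : PPOrd m := by
  obtain ⟨r, k, hr, rfl⟩ := hn
  obtain ⟨j, -, hj⟩ := (Nat.dvd_prime_pow hr).mp h
  exact ⟨r, j, hr, hj⟩

lemma PPOrd.eq_of_dvd {n r s : ℕ} (hn : PPOrd n) (hr : r.Prime) (hs : s.Prime) (h1 : r ∣ n)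
    (h2 : s ∣ n) : r = s := by
  obtain ⟨t, k, ht, rfl⟩ := hn
  rw [(Nat.prime_dvd_prime_iff_eq hr ht).mp (hr.dvd_of_dvd_pow h1),
    (Nat.prime_dvd_prime_iff_eq hs ht).mp (hs.dvd_of_dvd_pow h2)]

lemma PPOrd.eq_pow {n r : ℕ} (hn : PPOrd n) (hr : r.Prime) (h1 : r ∣ n) : ∃ k, n = r ^ k := by
  obtain ⟨t, k, ht, rfl⟩ := hn
  rw [(Nat.prime_dvd_prime_iff_eq hr ht).mp (hr.dvd_of_dvd_pow h1)]
  exact ⟨k, rfl⟩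

lemma aux_not_pp {G : Type*} [Group G] {x y : G} {r p i j : ℕ} (hr : r.Prime) (hp : p.Prime)
    (hrp : r ≠ p) (hx : orderOf x = r ^ i) (hy : orderOf y = p ^ j) (hx1 : x ≠ 1) (hy1 : y ≠ 1)
    (hc : Commute x y) (h : PPOrd (orderOf (x * y))) : False := by
  have hcop : (orderOf x).Coprime (orderOf y) := by
    rw [hx, hy]
    exact Nat.Coprime.pow _ _ ((Nat.coprime_primes hr hp).mpr hrp)
  rw [hc.orderOf_mul_eq_mul_orderOf_of_coprime hcop] at h
  have hi : i ≠ 0 := by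
    rintro rfl
    exact hx1 (orderOf_eq_one_iff.mp (by simpa using hx))
  have hj : j ≠ 0 := by
    rintro rfl
    exact hy1 (orderOf_eq_one_iff.mp (by simpa using hy))
  refine hrp (h.eq_of_dvd hr hp ?_ ?_)
  · exact Dvd.dvd.mul_right (hx ▸ dvd_pow_self r hi) _
  · exact Dvd.dvd.mul_left (hy ▸ dvd_pow_self p hj) _

lemma aux_fix {G Q : Type*} [Group G] [Group Q] {f : G →* Q} (hE : HypE f) {x y : G} {r p j : ℕ}
    (hr : r.Prime) (hp : p.Prime) (hrp : r ≠ p) (hx : f x ≠ 1) (hrx : r ∣ orderOf x)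
    (hy : orderOf y = p ^ j) (hfy : f y = 1) (hc : Commute x y) : y = 1 := by
  by_contra hy1
  obtain ⟨i, hi⟩ := (hE x hx).eq_pow hr hrx
  refine aux_not_pp hr hp hrp hi hy (fun h => hx (by rw [h, map_one])) hy1 hc (hE _ ?_)
  rwa [map_mul, hfy, mul_one]

def Good (p : ℕ) (Q : Type u) [Group Q] : Prop :=
  ∃ (A : Type u) (_ : CommGroup A) (_ : Finite A) (φ : Q →* MulAut A), Nontrivial A ∧
    IsPGroup p A ∧ ∀ r : ℕ, r.Prime → r ≠ p → ∀ g : Q, g ^ r = 1 → g ≠ 1 → ∀ a, φ g a = a → a = 1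

lemma aux_good {H Q : Type u} [Group H] [Finite H] [Group Q] (f : H →* Q)
    (hf : Function.Surjective f) (hE : HypE f) (p : ℕ) [hp : Fact p.Prime]
    (hK : IsPGroup p f.ker) (hK1 : Nontrivial f.ker) : Good p Q := by
  let A : Subgroup H := f.ker ⊓ centralizer (f.ker : Set H)
  have hAn : A.Normal := inferInstance
  have hAK : A ≤ f.ker := inf_le_left
  have hcomm : ∀ a ∈ A, ∀ b ∈ f.ker, b * a = a * b := fun a ha b hb =>
    Subgroup.mem_centralizer_iff.mp ha.2 b hb
  let _ : CommGroup A := { (inferInstance : Group A) with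
    mul_comm := fun a b => Subtype.ext (hcomm b b.2 a (hAK a.2)) }
  have hker : f.ker ≤ (MulAut.conjNormal (H := A)).ker := by
    intro x hx
    rw [MonoidHom.mem_ker]
    ext a
    rw [MulAut.conjNormal_apply, hcomm a a.2 x hx]
    simp
  refine ⟨A, inferInstance, inferInstance,
    f.liftOfSurjective hf ⟨MulAut.conjNormal, hker⟩, ?_, hK.to_le hAK, ?_⟩
  · have := hK.center_nontrivial
    obtain ⟨z, hz⟩ := exists_ne (1 : center f.ker)
    refine ⟨⟨⟨z.1.1, z.1.2, ?_⟩, 1, fun h => hz ?_⟩⟩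
    · refine Subgroup.mem_centralizer_iff.mpr ?_
      intro b hb
      exact congrArg Subtype.val (Subgroup.mem_center_iff.mp z.2 ⟨b, hb⟩)
    · have h1 : ((z : f.ker) : H) = 1 := congrArg (fun t : A => (t : H)) h
      exact Subtype.ext (Subtype.ext h1)
  · intro r hr hrp g hgr hg1 a ha
    obtain ⟨h, rfl⟩ := hf g
    have e : f.liftOfSurjective hf ⟨MulAut.conjNormal (H := A), hker⟩ (f h) =
        MulAut.conjNormal h := MonoidHom.liftOfRightInverse_comp_apply _ _ _ _ _
    rw [e] at ha
    have ha' := congrArg Subtype.val ha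
    rw [MulAut.conjNormal_apply, mul_inv_eq_iff_eq_mul] at ha'
    have hro : r ∣ orderOf h := by
      have : Fact r.Prime := ⟨hr⟩
      rw [← orderOf_eq_prime hgr hg1]
      exact orderOf_map_dvd f h
    obtain ⟨j, hj⟩ := IsPGroup.iff_orderOf.mp (hK.to_le hAK) a
    rw [← Subgroup.orderOf_coe] at hj
    exact Subtype.ext (aux_fix hE hr hp.out hrp hg1 hro hj (hAK a.2) ha')

lemma aux_solv_of_hom {G H : Type*} [Group G] [Group H] (f : G →* H)
    (h1 : Group.IsSolvable f.ker) (h2 : Group.IsSolvable H) : Group.IsSolvable G :=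
  Group.isSolvable_of_ker_le_range f.ker.subtype f (by simp)

lemma aux_solv_pgroup {G : Type*} [Group G] [Finite G] (p : ℕ) [Fact p.Prime] (h : IsPGroup p G) :
    Group.IsSolvable G := by
  have := h.isNilpotent
  infer_instance

lemma aux_exists_prime_pow {G : Type*} [Group G] {g : G} {r k : ℕ} (hr : r.Prime)
    (hg : orderOf g = r ^ k) (hg1 : g ≠ 1) : ∃ m, (g ^ m) ^ r = 1 ∧ g ^ m ≠ 1 := by
  have : Fact r.Prime := ⟨hr⟩
  rcases k with _ | k
  · exact absurd (orderOf_eq_one_iff.mp (by simpa using hg)) hg1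
  · refine ⟨r ^ k, ?_, ?_⟩
    · rw [← pow_mul, ← pow_succ, ← hg, pow_orderOf_eq_one]
    · intro h
      have h2 := orderOf_dvd_of_pow_eq_one h
      rw [hg] at h2
      have := (Nat.pow_dvd_pow_iff_le_right hr.one_lt).mp h2
      omega

lemma aux_involution {Q : Type u} [Group Q] [Finite Q] (hQ : ∀ g : Q, PPOrd (orderOf g)) (p : ℕ)
    [hp : Fact p.Prime] (hp2 : p ≠ 2) (hG : Good p Q) (h2 : 2 ∣ Nat.card Q) :
    Group.IsSolvable Q := by
  obtain ⟨A, _, _, φ, hA, hAp, hfpf⟩ := hG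
  obtain ⟨a0, ha0⟩ := exists_ne (1 : A)
  have : Fact (Nat.Prime 2) := ⟨Nat.prime_two⟩
  obtain ⟨t, ht⟩ := exists_prime_orderOf_dvd_card' (G := Q) 2 h2
  have ht2 : t ^ 2 = 1 := by rw [← ht, pow_orderOf_eq_one]
  have ht1 : t ≠ 1 := by rintro rfl; simp at ht
  have hfp := hfpf 2 Nat.prime_two (Ne.symm hp2) t ht2 ht1
  have hinv : ∀ a, φ t a = a⁻¹ := by
    intro a
    have h1 : φ t (a * φ t a) = a * φ t a := by
      rw [map_mul, ← MulAut.mul_apply, ← map_mul, ← pow_two, ht2, map_one, MulAut.one_apply,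
        mul_comm]
    exact eq_inv_of_mul_eq_one_right (hfp _ h1)
  have hcen : ∀ g, Commute (φ g) (φ t) := by
    intro g
    ext a
    rw [MulAut.mul_apply, MulAut.mul_apply, hinv, hinv, map_inv]
  have hφt : φ t ≠ 1 := fun h => ha0 (hfp a0 (by rw [h, MulAut.one_apply]))
  have hφt2 : orderOf (φ t) = 2 ^ 1 := by
    rw [pow_one]
    exact orderOf_eq_prime (by rw [← map_pow, ht2, map_one]) hφt
  have hpp : ∀ g, PPOrd (orderOf (φ g)) := fun g => (hQ g).of_dvd (orderOf_map_dvd φ g)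
  refine aux_solv_of_hom φ.rangeRestrict ?_ ?_
  · refine aux_solv_pgroup p (IsPGroup.iff_orderOf.mpr ?_)
    intro g
    rw [← Subgroup.orderOf_coe]
    obtain ⟨r, k, hr, hk⟩ := hQ g
    by_cases hrp : r = p
    · exact ⟨k, hrp ▸ hk⟩
    by_cases hg1 : (g : Q) = 1
    · exact ⟨0, by simp [hg1]⟩
    exfalso
    obtain ⟨m, hm, hm1⟩ := aux_exists_prime_pow hr hk hg1
    refine ha0 (hfpf r hr hrp _ hm hm1 a0 ?_)
    have hg : φ g = 1 := congrArg Subtype.val (MonoidHom.mem_ker.mp g.2)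
    rw [map_pow, hg, one_pow, MulAut.one_apply]
  · refine aux_solv_pgroup 2 (IsPGroup.iff_orderOf.mpr ?_)
    rintro ⟨_, g, rfl⟩
    rw [← Subgroup.orderOf_coe]
    obtain ⟨r, k, hr, hk⟩ := hpp g
    by_cases hrp : r = 2
    · exact ⟨k, hrp ▸ hk⟩
    by_cases hg1 : φ g = 1
    · exact ⟨0, by simp [hg1]⟩
    exfalso
    refine aux_not_pp hr Nat.prime_two hrp hk hφt2 hg1 hφt (hcen g) ?_
    rw [← map_mul]
    exact hpp _

lemma aux_two_good {Q : Type u} [Group Q] [Finite Q] (hQ : ∀ g : Q, PPOrd (orderOf g)) (p q : ℕ)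
    [hp : Fact p.Prime] [hq : Fact q.Prime] (hpq : p ≠ q) (hGp : Good p Q) (hGq : Good q Q) :
    Group.IsSolvable Q := by
  by_cases h2 : 2 ∣ Nat.card Q
  · by_cases hp2 : p = 2
    · exact aux_involution hQ q (fun h => hpq (hp2.trans h.symm)) hGq h2
    · exact aux_involution hQ p hp2 hGp h2
  · have key : ∀ (r s : ℕ) [Fact r.Prime] [Fact s.Prime] (P : Sylow r Q), r ≠ 2 → s ≠ r →
        Good s Q → IsCyclic P := by
      intro r s hr _ P hr2 hsr hG
      obtain ⟨A, _, _, φ, hA, hAp, hfpf⟩ := hG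
      refine aux_cyclic_act (φ.comp (P : Subgroup Q).subtype) s r hsr hr2 hAp P.isPGroup' ?_
      intro g hg hg1 a ha
      refine hfpf r hr.out (Ne.symm hsr) g ?_ ?_ a ha
      · exact_mod_cast congrArg Subtype.val hg
      · exact fun h => hg1 (Subtype.ext h)
    have : IsZGroup Q := by
      rw [isZGroup_iff]
      intro r hr P
      have : Fact r.Prime := ⟨hr⟩
      by_cases hr2 : r = 2
      · subst hr2
        have : Subsingleton P := by
          rcases P.isPGroup'.card_eq_or_dvd with h | h
          · exact (Nat.card_eq_one_iff_unique.mp h).1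
          · exact absurd (h.trans (Subgroup.card_subgroup_dvd_card _)) h2
        infer_instance
      · by_cases hrp : p = r
        · exact key r q P hr2 (fun h => hpq (hrp.trans h.symm)) hGq
        · exact key r p P hr2 hrp hGp
    infer_instance

lemma aux_conj_mem {H : Type*} [Group H] (A : Subgroup H) (d : H)
    (hd : ∀ a ∈ A, d⁻¹ * a * d ∈ A) (i : ℕ) : ∀ a ∈ A, (d ^ i)⁻¹ * a * d ^ i ∈ A := by
  induction i with
  | zero => simp
  | succ n ih =>
    intro a ha
    have := hd _ (ih a ha)
    have e : (d ^ (n+1))⁻¹ * a * d ^ (n+1) = d⁻¹ * ((d ^ n)⁻¹ * a * d ^ n) * d := by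
      rw [pow_succ]; group
    rwa [e]

theorem aux_key {H V : Type*} [Group H] [CommGroup V] (φ : H →* MulAut V) (A : Subgroup H)
    [Finite A] (hA : ∀ a ∈ A, ∀ b ∈ A, a * b = b * a) (d : H) (hd : ∀ a ∈ A, d⁻¹ * a * d ∈ A)
    (r : ℕ) [hr : Fact r.Prime] (hdr : d ^ r = 1) (hfp : ∀ v, φ d v = v → v = 1)
    (hcop : ∀ v : V, v ^ Nat.card A = 1 → v = 1) (c : H) (hc : c ∈ A) (v : V) :
    φ (d⁻¹ * c⁻¹ * d * c) v = v := by
  have _ := Fintype.ofFinite A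
  let F : ℕ → V →* V := fun i =>
    { toFun := fun v => ∏ b : A, φ ((b : H)⁻¹ * d ^ i * b) v
      map_one' := by simp
      map_mul' := by intro x y; simp [Finset.prod_mul_distrib] }
  have hF : ∀ i v, F i v = ∏ b : A, φ ((b : H)⁻¹ * d ^ i * b) v := fun _ _ => rfl
  have hsum : ∀ v, ∏ i ∈ Finset.range r, F i v = 1 := by
    intro v
    simp only [hF]
    rw [Finset.prod_comm]
    refine Finset.prod_eq_one fun b _ => ?_
    have h1 := aux_prod_fixed φ r d hdr hfp (φ b v)
    have h2 := congrArg (φ (b : H)⁻¹) h1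
    rw [map_prod, map_one] at h2
    rw [← h2]
    refine Finset.prod_congr rfl fun i _ => ?_
    rw [map_mul, map_mul, MulAut.mul_apply, MulAut.mul_apply]
  have hinv1 : ∀ i, ∀ c ∈ A, ∀ v, F i (φ ((d ^ i)⁻¹ * c⁻¹ * d ^ i * c) v) = F i v := by
    intro i c hc v
    rw [hF, hF]
    symm
    refine Fintype.prod_equiv (Equiv.mulRight (⟨c, hc⟩ : A)⁻¹) _ _ fun b => ?_
    rw [← MulAut.mul_apply, ← map_mul]
    congr 2
    simp only [Equiv.coe_mulRight, Subgroup.coe_mul, Subgroup.coe_inv]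
    have hy : (d ^ i)⁻¹ * c⁻¹ * d ^ i ∈ A := aux_conj_mem A d hd i _ (inv_mem hc)
    have hb := b.2
    set y := (d ^ i)⁻¹ * c⁻¹ * d ^ i with hyd
    have e1 : c * d ^ i * y = d ^ i := by rw [hyd]; group
    have hx : (b : H) * c⁻¹ ∈ A := mul_mem hb (inv_mem hc)
    have e2 : (b : H) * c⁻¹ * (y * c) = y * b := by
      rw [hA _ hx _ (mul_mem hy hc)]
      rw [mul_assoc, ← mul_assoc c, hA c hc b hb]; group
    have e3 : ((b : H) * c⁻¹)⁻¹ = (b : H)⁻¹ * c := by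
      rw [mul_inv_rev, inv_inv, hA c hc _ (inv_mem hb)]
    calc (b : H)⁻¹ * d ^ i * b = (b : H)⁻¹ * (c * d ^ i * y) * b := by rw [e1]
      _ = (b : H)⁻¹ * c * d ^ i * (y * b) := by group
      _ = ((b : H) * c⁻¹)⁻¹ * d ^ i * ((b : H) * c⁻¹) * (y * c) := by rw [← e2, e3]; group
  have hinv2 : ∀ i j, ∀ c ∈ A, ∀ v,
      F i (φ (((d ^ i) ^ j)⁻¹ * c⁻¹ * (d ^ i) ^ j * c) v) = F i v := by
    intro i j
    induction j with
    | zero => intro c hc v; simp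
    | succ j ih =>
      intro c hc v
      set e := d ^ i with he
      have hce : e⁻¹ * c * e ∈ A := aux_conj_mem A d hd i _ hc
      have e1 : (e ^ (j+1))⁻¹ * c⁻¹ * e ^ (j+1) * c =
          ((e ^ j)⁻¹ * (e⁻¹ * c * e)⁻¹ * e ^ j * (e⁻¹ * c * e)) * (e⁻¹ * c⁻¹ * e * c) := by
        rw [pow_succ']; group
      rw [e1, map_mul, MulAut.mul_apply, ih _ hce, hinv1 i c hc]
  have hinv3 : ∀ i ∈ Finset.range r, i ≠ 0 → F i (φ (d⁻¹ * c⁻¹ * d * c) v) = F i v := by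
    intro i hi hi0
    have hcp : Nat.Coprime i r := by
      rw [Nat.coprime_comm]
      exact (Nat.Prime.coprime_iff_not_dvd hr.out).mpr fun h =>
        absurd (Nat.le_of_dvd (Nat.pos_of_ne_zero hi0) h) (not_le.mpr (Finset.mem_range.mp hi))
    obtain ⟨j, -, hj⟩ := Nat.exists_mul_mod_eq_one_of_coprime hcp hr.out.one_lt
    have hdj : (d ^ i) ^ j = d := by
      rw [← pow_mul, ← Nat.div_add_mod (i * j) r, hj, pow_add, pow_mul, hdr, one_pow, one_mul,
        pow_one]
    have := hinv2 i j c hc v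
    rwa [hdj] at this
  have hu := hsum (v * (φ (d⁻¹ * c⁻¹ * d * c) v)⁻¹)
  rw [Finset.prod_eq_single 0] at hu
  · rw [hF] at hu
    simp only [pow_zero, mul_one, inv_mul_cancel, map_one, MulAut.one_apply, Finset.prod_const,
      Finset.card_univ, ← Nat.card_eq_fintype_card] at hu
    exact (mul_inv_eq_one.mp (hcop _ hu)).symm
  · intro i hi hi0
    rw [map_mul, map_inv, hinv3 i hi hi0, mul_inv_cancel]
  · intro h
    exact absurd (Finset.mem_range.mpr hr.out.pos) h

lemma aux_order_one {G : Type*} [Group G] {x : G} {p q i j : ℕ} (hp : p.Prime) (hq : q.Prime)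
    (hpq : p ≠ q) (h1 : orderOf x ∣ p ^ i) (h2 : orderOf x ∣ q ^ j) : x = 1 := by
  rw [← orderOf_eq_one_iff]
  exact Nat.eq_one_of_dvd_coprimes
    (Nat.Coprime.pow i j ((Nat.coprime_primes hp hq).mpr hpq)) h1 h2

lemma aux_pgroup_order {G : Type*} [Group G] {p : ℕ} [Fact p.Prime] {K : Subgroup G}
    (hK : IsPGroup p K) {x : G} (hx : x ∈ K) : ∃ k, orderOf x = p ^ k := by
  obtain ⟨k, hk⟩ := IsPGroup.iff_orderOf.mp hK ⟨x, hx⟩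
  exact ⟨k, by rw [← hk, Subgroup.orderOf_mk]⟩

lemma aux_pgroup_of_primes {G : Type*} [Group G] [Finite G] (p : ℕ)
    (h : ∀ r : ℕ, r.Prime → r ∣ Nat.card G → r = p) : IsPGroup p G :=
  IsPGroup.of_card (Nat.eq_prime_pow_of_unique_prime_dvd (Nat.card_pos).ne' (fun {r} => h r))

lemma aux_quot_pp {G Q : Type*} [Group G] [Group Q] (f : G →* Q) (hf : Function.Surjective f)
    (hE : HypE f) (g : Q) : PPOrd (orderOf g) := by
  by_cases hg : g = 1
  · exact ⟨2, 0, Nat.prime_two, by simp [hg]⟩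
  obtain ⟨x, rfl⟩ := hf g
  exact (hE x hg).of_dvd (orderOf_map_dvd f x)

theorem aux_final {G Q : Type u} [Group G] [Finite G] [Group Q] [Finite Q] (f : G →* Q)
    (hE : HypE f) (hns : ¬ Group.IsSolvable Q) (p q : ℕ)
    [hp : Fact p.Prime] [hq : Fact q.Prime] (hpq : p ≠ q) (L : Subgroup G) [hLn : L.Normal]
    (hLf : L ≤ f.ker) (hLc : ∀ a ∈ L, ∀ b ∈ L, a * b = b * a) (hLq : IsPGroup q L)
    (H : Subgroup G) (hH : Function.Surjective (f.comp H.subtype))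
    (hK : IsPGroup p (f.comp H.subtype).ker) (hK1 : Nontrivial (f.comp H.subtype).ker)
    (hfaith : ∀ a : H, a ∈ (f.comp H.subtype).ker ⊓ centralizer ((f.comp H.subtype).ker : Set H) →
      (∀ l ∈ L, (a : G) * l = l * a) → a = 1) : False := by
  have hEg : HypE (f.comp H.subtype) := by
    intro x hx
    rw [← Subgroup.orderOf_coe]
    exact hE x hx
  have hgood := aux_good _ hH hEg p hK hK1
  have hQ := aux_quot_pp _ hH hEg
  have hgf : ∀ x : H, (f.comp H.subtype) x = f x := fun _ => rfl
  generalize f.comp H.subtype = g at *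
  set A : Subgroup H := g.ker ⊓ centralizer (g.ker : Set H) with hAdef
  have hAn : A.Normal := inferInstance
  have hAK : A ≤ g.ker := inf_le_left
  have hAp : IsPGroup p A := hK.to_le hAK
  have hAc : ∀ a ∈ A, ∀ b ∈ A, a * b = b * a := fun a ha b hb =>
    Subgroup.mem_centralizer_iff.mp hb.2 a (hAK ha)
  obtain ⟨a0, ha0, ha01⟩ : ∃ a ∈ A, a ≠ 1 := by
    have := hK.center_nontrivial
    obtain ⟨z, hz⟩ := exists_ne (1 : center g.ker)
    refine ⟨z.1.1, ⟨z.1.2, ?_⟩, fun h => hz ?_⟩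
    · refine Subgroup.mem_centralizer_iff.mpr ?_
      intro b hb
      exact congrArg Subtype.val (Subgroup.mem_center_iff.mp z.2 ⟨b, hb⟩)
    · exact Subtype.ext (Subtype.ext h)
  have hker : ∀ (x : H) (r i : ℕ), r.Prime → r ≠ p → orderOf x = r ^ i → x ≠ 1 → g x ≠ 1 := by
    intro x r i hr hrp hx hx1 hgx
    obtain ⟨k, hk⟩ := aux_pgroup_order hK (MonoidHom.mem_ker.mpr hgx)
    exact hx1 (aux_order_one hr hp.out hrp hx.dvd hk.dvd)
  have claim1 : ∀ (d : H) (r : ℕ), r.Prime → r ≠ q → orderOf d = r → g d ≠ 1 →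
      ∀ c ∈ A, d * c = c * d := by
    intro d r hr hrq hd hgd c hc
    have hrF : Fact r.Prime := ⟨hr⟩
    let _ : CommGroup L := { (inferInstance : Group L) with
      mul_comm := fun a b => Subtype.ext (hLc a a.2 b b.2) }
    let φ : H →* MulAut L := (MulAut.conjNormal (H := L)).comp H.subtype
    have hφ : ∀ (x : H) (v : L), ((φ x v : L) : G) = x * v * (x : G)⁻¹ := fun x v =>
      MulAut.conjNormal_apply (x : G) v
    have hLo : ∀ v : L, ∃ k, orderOf (v : G) = q ^ k := fun v => aux_pgroup_order hLq v.2
    have hy : d⁻¹ * c⁻¹ * d * c ∈ A := by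
      refine mul_mem ?_ hc
      have := hAn.conj_mem c⁻¹ (inv_mem hc) d⁻¹
      simpa using this
    have hkey := aux_key φ A hAc d
      (fun a ha => by simpa using hAn.conj_mem a ha d⁻¹) r
      (by rw [← hd, pow_orderOf_eq_one]) ?_ ?_ c hc
    · have h1 := hfaith _ hy ?_
      · have : d * c = c * d * (d⁻¹ * c⁻¹ * d * c) := by group
        rw [this, h1, mul_one]
      · intro l hl
        have := congrArg Subtype.val (hkey ⟨l, hl⟩)
        rw [hφ, mul_inv_eq_iff_eq_mul] at this
        exact this
    · intro v hv
      have := congrArg Subtype.val hv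
      rw [hφ, mul_inv_eq_iff_eq_mul] at this
      obtain ⟨k, hk⟩ := hLo v
      refine Subtype.ext (aux_fix hE hr hq.out hrq (x := (d : G)) ?_ ?_ hk (hLf v.2) this)
      · rw [← hgf]; exact hgd
      · rw [Subgroup.orderOf_coe, hd]
    · intro v hv
      obtain ⟨n, hn⟩ := IsPGroup.iff_card.mp hAp
      rw [hn] at hv
      obtain ⟨k, hk⟩ := hLo v
      rw [Subgroup.orderOf_coe] at hk
      exact aux_order_one hp.out hq.out hpq (orderOf_dvd_of_pow_eq_one hv) hk.dvd
  have claim2 : ∀ (x : H) (r : ℕ), r.Prime → r ≠ p → g x ≠ 1 → r ∣ orderOf x →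
      ¬ (∀ c ∈ A, x * c = c * x) := by
    intro x r hr hrp hgx hrx hc
    obtain ⟨k, hk⟩ := aux_pgroup_order hAp ha0
    exact ha01 (aux_fix hEg hr hp.out hrp hgx hrx hk (hAK ha0) (hc a0 ha0))
  have hprimes : ∀ r : ℕ, r.Prime → r ∣ Nat.card H → r = p ∨ r = q := by
    intro r hr hrd
    by_contra! hcon
    have hrF : Fact r.Prime := ⟨hr⟩
    obtain ⟨d, hd⟩ := exists_prime_orderOf_dvd_card' (G := H) r hrd
    have hgd : g d ≠ 1 := hker d r 1 hr hcon.1 (by rw [hd, pow_one]) (by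
      rintro rfl
      rw [orderOf_one] at hd
      exact hr.one_lt.ne hd)
    exact claim2 d r hr hcon.1 hgd hd.symm.dvd (claim1 d r hr hcon.2 hd hgd)
  have hHns : ¬ Group.IsSolvable H := fun h => hns (Group.isSolvable_of_surjective hH)
  by_cases hqd : q ∣ Nat.card H
  swap
  · refine hHns (aux_solv_pgroup p (aux_pgroup_of_primes p ?_))
    intro r hr hrd
    rcases hprimes r hr hrd with h | h
    · exact h
    · exact absurd (h ▸ hrd) hqd
  obtain ⟨t0, ht0⟩ := exists_prime_orderOf_dvd_card' (G := H) q hqd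
  have hq2 : q ≠ 2 := by
    rintro rfl
    have ht01 : t0 ≠ 1 := by rintro rfl; simp at ht0
    have hgt := hker t0 2 1 Nat.prime_two (Ne.symm hpq) (by rw [ht0, pow_one]) ht01
    refine hns (aux_involution hQ p hpq hgood ?_)
    have : orderOf (g t0) = 2 :=
      orderOf_eq_prime (by rw [← map_pow, ← ht0, pow_orderOf_eq_one, map_one]) hgt
    rw [← this]
    exact orderOf_dvd_natCard _
  obtain ⟨T⟩ : Nonempty (Sylow q H) := inferInstance
  have hTo : ∀ t ∈ T, ∃ k, orderOf t = q ^ k := fun t ht => aux_pgroup_order T.isPGroup' ht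
  have hTk : ∀ t ∈ T, t ≠ 1 → g t ≠ 1 ∧ q ∣ orderOf t := by
    intro t ht ht1
    obtain ⟨k, hk⟩ := hTo t ht
    refine ⟨hker t q k hq.out (Ne.symm hpq) hk ht1, ?_⟩
    rcases k with _ | k
    · exact absurd (orderOf_eq_one_iff.mp (by simpa using hk)) ht1
    · rw [hk]; exact dvd_pow_self q (by omega)
  have hTcyc : IsCyclic T := by
    obtain ⟨B, _, _, φ, hB, hBp, hfpf⟩ := hgood
    refine aux_cyclic_act ((φ.comp g).comp (T : Subgroup H).subtype) p q hpq hq2 hBp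
      T.isPGroup' ?_
    intro x hx hx1 a ha
    refine hfpf q hq.out (Ne.symm hpq) (g x) ?_ ?_ a ha
    · have : (x : H) ^ q = 1 := by exact_mod_cast congrArg Subtype.val hx
      rw [← map_pow, this, map_one]
    · exact (hTk x x.2 fun h => hx1 (Subtype.ext h)).1
  have hTcomm : ∀ a ∈ T, ∀ b ∈ T, a * b = b * a := by
    intro a ha b hb
    let _ := IsCyclic.commGroup (α := T)
    exact congrArg Subtype.val (mul_comm (⟨a, ha⟩ : T) ⟨b, hb⟩)
  obtain ⟨t, ht, ht1⟩ : ∃ t ∈ T, t ≠ 1 := by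
    have := T.ne_bot_of_dvd_card hqd
    exact (Subgroup.ne_bot_iff_exists_ne_one.mp this).elim fun x hx =>
      ⟨x, x.2, fun h => hx (Subtype.ext h)⟩
  obtain ⟨hgt, hqt⟩ := hTk t ht ht1
  obtain ⟨j, hj⟩ := hTo t ht
  have hnop : ∀ d ∈ normalizer ((T : Subgroup H) : Set H), orderOf d ≠ p := by
    intro d hdN hd
    have hd1 : d ≠ 1 := by
      rintro rfl
      rw [orderOf_one] at hd
      exact hp.out.one_lt.ne hd
    have hncomm : ¬ Commute d t := by
      intro hc
      refine aux_not_pp hp.out hq.out hpq (i := 1) (by rw [hd, pow_one]) hj hd1 ht1 hc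
        (hEg _ fun h => hgt ?_)
      rw [map_mul] at h
      have h1 : g t = (g d)⁻¹ := eq_inv_of_mul_eq_one_right h
      refine aux_order_one hp.out hq.out hpq (i := 1) (j := j) ?_ ?_
      · rw [h1, orderOf_inv, pow_one, ← hd]
        exact orderOf_map_dvd g d
      · rw [← hj]
        exact orderOf_map_dvd g t
    have heT : d * t * d⁻¹ * t⁻¹ ∈ T :=
      mul_mem ((Subgroup.mem_normalizer_iff.mp hdN t).mp ht) (inv_mem ht)
    have he1 : d * t * d⁻¹ * t⁻¹ ≠ 1 := by
      intro h
      refine hncomm ?_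
      have : d * t = (d * t * d⁻¹ * t⁻¹) * (t * d) := by group
      rw [h, one_mul] at this
      exact this
    obtain ⟨hge, hqe⟩ := hTk _ heT he1
    have hgd : g d ≠ 1 := by
      intro h
      apply hge
      simp [h]
    have hdA := claim1 d p hp.out hpq hd hgd
    have hdC : d ∈ centralizer (A : Set H) := Subgroup.mem_centralizer_iff.mpr
      fun c hc => (hdA c hc).symm
    have heC : d * t * d⁻¹ * t⁻¹ ∈ centralizer (A : Set H) := by
      have h1 : t * d⁻¹ * t⁻¹ ∈ centralizer (A : Set H) :=
        (inferInstance : (centralizer (A : Set H)).Normal).conj_mem _ (inv_mem hdC) t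
      have h2 := mul_mem hdC h1
      have e : d * t * d⁻¹ * t⁻¹ = d * (t * d⁻¹ * t⁻¹) := by group
      rw [e]; exact h2
    exact claim2 _ q hq.out (Ne.symm hpq) hge hqe
      fun c hc => (Subgroup.mem_centralizer_iff.mp heC c hc).symm
  have hN : normalizer ((T : Subgroup H) : Set H) ≤ centralizer ((T : Subgroup H) : Set H) := by
    have hpg : IsPGroup q (normalizer ((T : Subgroup H) : Set H)) := by
      refine aux_pgroup_of_primes q ?_
      intro r hr hrd
      rcases hprimes r hr (hrd.trans (Subgroup.card_subgroup_dvd_card _)) with h | h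
      · subst h
        obtain ⟨d, hd⟩ := exists_prime_orderOf_dvd_card'
          (G := normalizer ((T : Subgroup H) : Set H)) r hrd
        exact absurd (by rw [Subgroup.orderOf_coe, hd]) (hnop d d.2)
      · exact h
    have heq := T.is_maximal' hpg Subgroup.le_normalizer
    rw [heq]
    intro x hx
    exact Subgroup.mem_centralizer_iff.mpr fun y hy => hTcomm y hy x hx
  refine hHns (aux_solv_of_hom (MonoidHom.transferSylow T hN) ?_ ?_)
  · refine aux_solv_pgroup p (aux_pgroup_of_primes p ?_)
    intro r hr hrd
    rcases hprimes r hr (hrd.trans (Subgroup.card_subgroup_dvd_card _)) with h | h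
    · exact h
    · exact absurd (h ▸ hrd) (MonoidHom.not_dvd_card_ker_transferSylow T hN)
  · exact aux_solv_pgroup q T.isPGroup'

theorem aux_main {Q : Type u} [Group Q] [Finite Q] (hns : ¬ Group.IsSolvable Q) :
    ∀ (n : ℕ) (G : Type u) [Group G] [Finite G] (f : G →* Q), Nat.card G = n →
      Function.Surjective f → HypE f → ∃ p : ℕ, p.Prime ∧ IsPGroup p f.ker := by
  intro n
  induction n using Nat.strong_induction_on with
  | _ n ih =>
  intro G _ _ f hn hf hE
  by_contra hno
  push Not at hno
  have hQ := aux_quot_pp f hf hE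
  have huniq : ∀ p q : ℕ, p.Prime → q.Prime → Good p Q → Good q Q → p = q := by
    intro p q hp hq h1 h2
    have : Fact p.Prime := ⟨hp⟩
    have : Fact q.Prime := ⟨hq⟩
    by_contra h
    exact hns (aux_two_good hQ p q h h1 h2)
  have hquot : ∀ K : Subgroup G, K.Normal → K ≤ f.ker → K ≠ ⊥ → K ≠ f.ker →
      ∃ p : ℕ, p.Prime ∧ Good p Q ∧ ∀ x ∈ f.ker, ∃ k, x ^ p ^ k ∈ K := by
    intro K hKn hKf hK1 hK2
    let f' : G ⧸ K →* Q := QuotientGroup.lift K f hKf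
    have hf' : ∀ x : G, f' (x : G ⧸ K) = f x := fun x => rfl
    have hsurj : Function.Surjective f' := fun y => by
      obtain ⟨x, rfl⟩ := hf y
      exact ⟨x, rfl⟩
    have hE' : HypE f' := by
      intro y
      induction y using QuotientGroup.induction_on with
      | H x =>
      intro hx
      exact (hE x hx).of_dvd (orderOf_map_dvd (QuotientGroup.mk' K) x)
    have hcard : Nat.card (G ⧸ K) < n := by
      have h1 := K.card_mul_index
      have h2 : 1 < Nat.card K := by
        rw [Subgroup.one_lt_card_iff_ne_bot]; exact hK1
      have h3 : 0 < Nat.card (G ⧸ K) := Nat.card_pos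
      change Nat.card K * Nat.card (G ⧸ K) = Nat.card G at h1
      rw [← hn, ← h1]
      nlinarith
    obtain ⟨p, hp, hpK⟩ := ih _ hcard (G ⧸ K) f' rfl hsurj hE'
    have : Fact p.Prime := ⟨hp⟩
    refine ⟨p, hp, aux_good f' hsurj hE' p hpK ?_, ?_⟩
    · obtain ⟨x, hx, hxK⟩ : ∃ x ∈ f.ker, x ∉ K := by
        by_contra! h
        exact hK2 (le_antisymm hKf h)
      refine ⟨⟨⟨(x : G ⧸ K), hx⟩, 1, fun h => hxK ?_⟩⟩
      exact (QuotientGroup.eq_one_iff x).mp (congrArg Subtype.val h)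
    · intro x hx
      obtain ⟨k, hk⟩ := hpK ⟨(x : G ⧸ K), hx⟩
      refine ⟨k, ?_⟩
      rw [← QuotientGroup.eq_one_iff]
      exact congrArg Subtype.val hk
  have hmapp : ∀ (s : ℕ) (P : Sylow s f.ker), IsPGroup s ((P : Subgroup f.ker).map f.ker.subtype) :=
    fun s P => P.isPGroup'.map _
  have hmaple : ∀ (s : ℕ) (P : Sylow s f.ker), (P : Subgroup f.ker).map f.ker.subtype ≤ f.ker :=
    fun s P => Subgroup.map_subtype_le _
  have hmapne : ∀ (s : ℕ) [Fact s.Prime] (P : Sylow s f.ker), s ∣ Nat.card f.ker →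
      (P : Subgroup f.ker).map f.ker.subtype ≠ ⊥ := by
    intro s _ P hd h
    rw [Subgroup.map_eq_bot_iff_of_injective _ f.ker.subtype_injective] at h
    exact P.ne_bot_of_dvd_card hd h
  have hsyl : ∀ (s : ℕ) [Fact s.Prime] (P : Sylow s f.ker), s ∣ Nat.card f.ker →
      ((P : Subgroup f.ker).map f.ker.subtype).Normal ∨
      ∃ H : Subgroup G, (P : Subgroup f.ker).map f.ker.subtype ≤ H ∧ H ⊔ f.ker = ⊤ ∧
        Function.Surjective (f.comp H.subtype) ∧ IsPGroup s (f.comp H.subtype).ker ∧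
        Nontrivial (f.comp H.subtype).ker ∧ Good s Q := by
    intro s hs P hd
    set Pm := (P : Subgroup f.ker).map f.ker.subtype with hPm
    by_cases hH : normalizer (Pm : Set G) = ⊤
    · exact Or.inl (Subgroup.normalizer_eq_top_iff.mp hH)
    right
    set H := normalizer (Pm : Set G) with hHdef
    have hsup : H ⊔ f.ker = ⊤ := Sylow.normalizer_sup_eq_top P
    have hPH : Pm ≤ H := Subgroup.le_normalizer
    have hsurj : Function.Surjective (f.comp H.subtype) := by
      intro y
      obtain ⟨x, rfl⟩ := hf y
      have hx : x ∈ H ⊔ f.ker := by rw [hsup]; trivial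
      obtain ⟨h, hh, k, hk, rfl⟩ := Subgroup.mem_sup_of_normal_right.mp hx
      refine ⟨⟨h, hh⟩, ?_⟩
      rw [map_mul, MonoidHom.mem_ker.mp hk, mul_one]
      rfl
    have hEH : HypE (f.comp H.subtype) := by
      intro x hx
      rw [← Subgroup.orderOf_coe]
      exact hE x hx
    have hcard : Nat.card H < n := by
      rw [← hn]
      exact lt_of_le_of_ne (Subgroup.card_le_card_group H)
        fun h => hH (Subgroup.eq_top_of_card_eq H h)
    obtain ⟨p, hp, hpK⟩ := ih _ hcard H (f.comp H.subtype) rfl hsurj hEH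
    have hpF : Fact p.Prime := ⟨hp⟩
    obtain ⟨⟨x, hx⟩, hx1⟩ := Subgroup.ne_bot_iff_exists_ne_one.mp (hmapne s P hd)
    have hx1' : x ≠ 1 := fun h => hx1 (Subtype.ext h)
    have hxk : (⟨x, hPH hx⟩ : H) ∈ (f.comp H.subtype).ker := hmaple s P hx
    have hps : p = s := by
      by_contra hne
      obtain ⟨i, hi⟩ := aux_pgroup_order hpK hxk
      obtain ⟨j, hj⟩ := aux_pgroup_order (hmapp s P) hx
      rw [Subgroup.orderOf_mk] at hi
      exact hx1' (aux_order_one hp hs.out hne hi.dvd hj.dvd)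
    subst hps
    have hnt : Nontrivial (f.comp H.subtype).ker :=
      ⟨⟨⟨_, hxk⟩, 1, fun h => hx1'
        (congrArg (fun t : (f.comp H.subtype).ker => ((t : H) : G)) h)⟩⟩
    exact ⟨H, hPH, hsup, hsurj, hpK, hnt, aux_good _ hsurj hEH p hpK hnt⟩
  have hmaptop : ∀ (s : ℕ) (P : Sylow s f.ker), s.Prime →
      (P : Subgroup f.ker).map f.ker.subtype ≠ f.ker := by
    intro s P hs h
    have := hmapp s P
    rw [h] at this
    exact hno s hs this
  obtain ⟨p, hp, hgood⟩ : ∃ p : ℕ, p.Prime ∧ Good p Q := by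
    have hne : Nat.card f.ker ≠ 1 := fun h =>
      hno 2 Nat.prime_two (IsPGroup.of_card (n := 0) (by rw [h, pow_zero]))
    obtain ⟨s, hs, hsd⟩ := Nat.exists_prime_and_dvd hne
    have hsF : Fact s.Prime := ⟨hs⟩
    obtain ⟨P⟩ : Nonempty (Sylow s f.ker) := inferInstance
    rcases hsyl s P hsd with h | ⟨H, -, -, -, -, -, h⟩
    · obtain ⟨p, hp, hg, -⟩ := hquot _ h (hmaple s P) (hmapne s P hsd) (hmaptop s P hs)
      exact ⟨p, hp, hg⟩
    · exact ⟨s, hs, h⟩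
  have hpF : Fact p.Prime := ⟨hp⟩
  obtain ⟨q, hq, hqd, hqp⟩ : ∃ q : ℕ, q.Prime ∧ q ∣ Nat.card f.ker ∧ q ≠ p := by
    by_contra! h
    exact hno p hp (aux_pgroup_of_primes p h)
  have hqF : Fact q.Prime := ⟨hq⟩
  obtain ⟨S⟩ : Nonempty (Sylow q f.ker) := inferInstance
  have hLn : ((S : Subgroup f.ker).map f.ker.subtype).Normal := by
    rcases hsyl q S hqd with h | ⟨H, -, -, -, -, -, h⟩
    · exact h
    · exact absurd (huniq q p hq hp h hgood) hqp
  have hLq := hmapp q S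
  have hLf := hmaple q S
  have hL1 := hmapne q S hqd
  have hLt := hmaptop q S hq
  generalize (S : Subgroup f.ker).map f.ker.subtype = L at hLn hLq hLf hL1 hLt
  have hpow : ∀ K : Subgroup G, ∀ x : G, ∀ k, ¬ p ∣ orderOf x → x ^ p ^ k ∈ K → x ∈ K := by
    intro K x k hx hxk
    obtain ⟨m, hm⟩ := exists_pow_eq_self_of_coprime (x := x) (n := p ^ k)
      (Nat.Coprime.pow_left k ((Nat.Prime.coprime_iff_not_dvd hp).mpr hx))
    rw [← hm]
    exact pow_mem hxk m
  have hLo : ∀ x ∈ L, ¬ p ∣ orderOf x := by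
    intro x hx hd
    obtain ⟨k, hk⟩ := aux_pgroup_order hLq hx
    rw [hk] at hd
    exact hqp ((Nat.prime_dvd_prime_iff_eq hp hq).mp (hp.dvd_of_dvd_pow hd)).symm
  have hquot' : ∀ K : Subgroup G, K.Normal → K ≤ f.ker → K ≠ ⊥ → K ≠ f.ker →
      ∀ x ∈ f.ker, ∃ k, x ^ p ^ k ∈ K := by
    intro K hKn hKf hK1 hK2
    obtain ⟨t, ht, htg, hx⟩ := hquot K hKn hKf hK1 hK2
    rwa [huniq t p ht hp htg hgood] at hx
  have hmin : ∀ K : Subgroup G, K.Normal → K ≤ f.ker → K ≠ ⊥ → L ≤ K := by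
    intro K hKn hKf hK1
    by_cases hK2 : K = f.ker
    · rw [hK2]; exact hLf
    intro x hx
    obtain ⟨k, hk⟩ := hquot' K hKn hKf hK1 hK2 x (hLf hx)
    exact hpow K x k (hLo x hx) hk
  have hnotp : ∀ K : Subgroup G, IsPGroup p K → ¬ L ≤ K := by
    intro K hK hLK
    obtain ⟨⟨x, hx⟩, hx1⟩ := Subgroup.ne_bot_iff_exists_ne_one.mp hL1
    obtain ⟨i, hi⟩ := aux_pgroup_order hK (hLK hx)
    obtain ⟨j, hj⟩ := aux_pgroup_order hLq hx
    exact hx1 (Subtype.ext (aux_order_one hp hq (Ne.symm hqp) hi.dvd hj.dvd))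
  have hLc : ∀ a ∈ L, ∀ b ∈ L, a * b = b * a := by
    have hle : L ≤ L ⊓ centralizer (L : Set G) := by
      refine hmin _ inferInstance (inf_le_left.trans hLf) ?_
      have : Nontrivial L := (Subgroup.nontrivial_iff_ne_bot L).mpr hL1
      have := hLq.center_nontrivial
      obtain ⟨z, hz⟩ := exists_ne (1 : center L)
      refine Subgroup.ne_bot_iff_exists_ne_one.mpr ⟨⟨z.1.1, z.1.2, ?_⟩, fun h => hz ?_⟩
      · refine Subgroup.mem_centralizer_iff.mpr ?_
        intro b hb
        exact congrArg Subtype.val (Subgroup.mem_center_iff.mp z.2 ⟨b, hb⟩)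
      · have h1 : ((z : L) : G) = 1 :=
          congrArg (fun t : (L ⊓ centralizer (L : Set G) : Subgroup G) => (t : G)) h
        exact Subtype.ext (Subtype.ext h1)
    intro a ha b hb
    exact Subgroup.mem_centralizer_iff.mp (hle hb).2 a ha
  have hNL := hquot' L hLn hLf hL1 hLt
  have hpd : p ∣ Nat.card f.ker := by
    by_contra h
    refine hLt (le_antisymm hLf fun x hx => ?_)
    obtain ⟨k, hk⟩ := hNL x hx
    refine hpow L x k (fun hd => h (hd.trans ?_)) hk
    rw [← Subgroup.orderOf_mk x hx]
    exact orderOf_dvd_natCard _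
  obtain ⟨P⟩ : Nonempty (Sylow p f.ker) := inferInstance
  rcases hsyl p P hpd with h | ⟨H, hPH, hsup, hsurj, hK, hK1, -⟩
  · exact hnotp _ (hmapp p P) (hmin _ h (hmaple p P) (hmapne p P hpd))
  have hNHL : f.ker ≤ H ⊔ L := by
    intro x hx
    have hpq : IsPGroup p (f.ker ⧸ L.subgroupOf f.ker) := by
      intro y
      induction y using QuotientGroup.induction_on with
      | H y =>
      obtain ⟨k, hk⟩ := hNL y y.2
      refine ⟨k, ?_⟩
      have : y ^ p ^ k ∈ L.subgroupOf f.ker := by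
        rw [Subgroup.mem_subgroupOf]
        exact_mod_cast hk
      exact_mod_cast (QuotientGroup.eq_one_iff _).mpr this
    let P' := P.mapSurjective (QuotientGroup.mk'_surjective (L.subgroupOf f.ker))
    have hP' : (⊤ : Subgroup (f.ker ⧸ L.subgroupOf f.ker)) = P' :=
      P'.is_maximal' (hpq.to_subgroup ⊤) le_top
    have hmem : ((⟨x, hx⟩ : f.ker) : f.ker ⧸ L.subgroupOf f.ker) ∈
        (P' : Subgroup (f.ker ⧸ L.subgroupOf f.ker)) := by
      rw [← hP']; trivial
    rw [Sylow.coe_mapSurjective] at hmem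
    obtain ⟨y, hy, hyx⟩ := hmem
    have h1 : y⁻¹ * ⟨x, hx⟩ ∈ L.subgroupOf f.ker := QuotientGroup.eq.mp hyx
    rw [Subgroup.mem_subgroupOf] at h1
    have h2 : (y : G) ∈ H := hPH ⟨y, hy, rfl⟩
    have h3 : x = (y : G) * ((y : G)⁻¹ * x) := by group
    rw [h3]
    exact mul_mem (Subgroup.mem_sup_left h2) (Subgroup.mem_sup_right h1)
  have hHL : H ⊔ L = ⊤ := by
    rw [eq_top_iff, ← hsup]
    exact sup_le le_sup_left hNHL
  refine aux_final f hE hns p q (Ne.symm hqp) L hLf hLc hLq H hsurj hK hK1 ?_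
  intro a ha hal
  set A : Subgroup H := (f.comp H.subtype).ker ⊓
    centralizer ((f.comp H.subtype).ker : Set H) with hA
  have hAn : A.Normal := inferInstance
  let B : Subgroup G := A.map H.subtype ⊓ centralizer (L : Set G)
  have hBf : B ≤ f.ker := by
    rintro _ ⟨⟨b, hb, rfl⟩, -⟩
    exact hb.1
  have hBn : B.Normal := by
    rw [← Subgroup.normalizer_eq_top_iff, eq_top_iff, ← hHL]
    have hconj : ∀ h ∈ H, ∀ b ∈ B, h * b * h⁻¹ ∈ B := by
      rintro h hh _ ⟨⟨b, hb, rfl⟩, hb2⟩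
      refine ⟨⟨⟨h, hh⟩ * b * ⟨h, hh⟩⁻¹, hAn.conj_mem b hb _, rfl⟩, ?_⟩
      exact (inferInstance : (centralizer (L : Set G)).Normal).conj_mem _ hb2 h
    refine sup_le ?_ ?_
    · intro h hh
      rw [Subgroup.mem_normalizer_iff]
      intro b
      refine ⟨hconj h hh b, fun hb => ?_⟩
      have := hconj h⁻¹ (inv_mem hh) _ hb
      have e : h⁻¹ * (h * b * h⁻¹) * h⁻¹⁻¹ = b := by group
      rwa [e] at this
    · have hcl : ∀ l ∈ L, ∀ b ∈ B, l * b * l⁻¹ = b := by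
        intro l hl b hb
        rw [mul_inv_eq_iff_eq_mul]
        exact Subgroup.mem_centralizer_iff.mp hb.2 l hl
      intro l hl
      rw [Subgroup.mem_normalizer_iff]
      intro b
      refine ⟨fun hb => ?_, fun hb => ?_⟩
      · have := hcl l hl b hb
        exact this.symm ▸ hb
      · have := hcl l⁻¹ (inv_mem hl) _ hb
        have e : l⁻¹ * (l * b * l⁻¹) * l⁻¹⁻¹ = b := by group
        rw [e] at this
        exact this.symm ▸ hb
  by_contra ha1
  have hB1 : B ≠ ⊥ := by
    refine Subgroup.ne_bot_iff_exists_ne_one.mpr ⟨⟨a, ⟨a, ha, rfl⟩, ?_⟩, fun h => ha1 ?_⟩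
    · exact Subgroup.mem_centralizer_iff.mpr fun l hl => (hal l hl).symm
    · have h1 : (a : G) = 1 := congrArg (fun t : B => (t : G)) h
      exact Subtype.ext h1
  exact hnotp (A.map H.subtype) ((hK.to_le inf_le_left).map _) ((hmin B hBn hBf hB1).trans inf_le_left)

theorem stmt_12 {G : Type*} [Group G] [Fintype G] (N : Subgroup G) [N.Normal]
    (hns : ¬ IsSolvable (G ⧸ N)) :
    (∀ g : G, g ∉ N → ∃ r k : ℕ, r.Prime ∧ orderOf g = r ^ k) ↔
    (∀ g : G, ∃ r k : ℕ, r.Prime ∧ orderOf g = r ^ k) := by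
  refine ⟨fun h g => ?_, fun h g _ => h g⟩
  by_cases hg : g ∈ N
  · obtain ⟨p, hp, hpN⟩ := aux_main hns _ G (QuotientGroup.mk' N) rfl
      (QuotientGroup.mk'_surjective N) (fun x hx => h x fun hxN => hx
        ((QuotientGroup.eq_one_iff x).mpr hxN))
    rw [QuotientGroup.ker_mk'] at hpN
    have : Fact p.Prime := ⟨hp⟩
    obtain ⟨k, hk⟩ := aux_pgroup_order hpN hg
    exact ⟨p, k, hp, hk⟩
  · exact h g hg
end

section
/- Let G be a finite group with a normal subgroup N such that every element of G \ N has prime power order and at least three distinct primes divide the orders of elements of G \ N. Then every element of G has prime power order. -/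
open Subgroup

lemma aux_comm {G : Type*} [Group G] [Finite G] (N : Subgroup G)
    (hppo : ∀ g : G, g ∉ N → ∃ r k : ℕ, r.Prime ∧ orderOf g = r ^ k)
    {p q : ℕ} (hp : p.Prime) (hq : q.Prime) (hpq : p ≠ q) {x y : G} (hx : x ∉ N)
    (hxo : ∃ k, orderOf x = p ^ k) (hyo : ∃ k, orderOf y = q ^ k) (hc : Commute x y) : y = 1 := by
  obtain ⟨k, hk⟩ := hxo
  obtain ⟨l, hl⟩ := hyo
  have hcop : (orderOf x).Coprime (orderOf y) := by
    rw [hk, hl]; exact Nat.coprime_pow_primes _ _ hp hq hpq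
  have hxy : x * y ∉ N := by
    intro h
    apply hx
    have h1 : (x * y) ^ orderOf y ∈ N := N.pow_mem h _
    rw [hc.mul_pow, pow_orderOf_eq_one, mul_one] at h1
    obtain ⟨m, hm⟩ := exists_pow_eq_self_of_coprime hcop.symm
    rw [← hm]
    exact N.pow_mem h1 _
  obtain ⟨s, m, hs, hm⟩ := hppo _ hxy
  rw [hc.orderOf_mul_eq_mul_orderOf_of_coprime hcop] at hm
  by_contra hy
  have hx1 : x ≠ 1 := fun h => hx (h ▸ N.one_mem)
  have hps : p = s := by
    have : p ∣ orderOf x := by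
      rw [hk]; apply dvd_pow_self
      rintro rfl
      exact hx1 (orderOf_eq_one_iff.1 (by simpa using hk))
    have := (this.mul_right (orderOf y))
    rw [hm] at this
    exact (Nat.prime_dvd_prime_iff_eq hp hs).1 (hp.dvd_of_dvd_pow this)
  have hqs : q = s := by
    have : q ∣ orderOf y := by
      rw [hl]; apply dvd_pow_self
      rintro rfl
      exact hy (orderOf_eq_one_iff.1 (by simpa using hl))
    have := (this.mul_left (orderOf x))
    rw [hm] at this
    exact (Nat.prime_dvd_prime_iff_eq hq hs).1 (hq.dvd_of_dvd_pow this)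
  exact hpq (hps.trans hqs.symm)

lemma aux_frob {F V : Type*} [Group F] [Finite F] [CommGroup V] (φ : F →* MulAut V)
    (A B : Subgroup F) (hBA : ∀ b ∈ B, ∀ a ∈ A, b * a * b⁻¹ ∈ A)
    (hfree : ∀ b ∈ B, b ≠ 1 → ∀ a ∈ A, a * b = b * a → a = 1)
    (hA : ∀ v, (∀ a ∈ A, φ a v = v) → v = 1)
    (hB : ∀ v, (∀ b ∈ B, φ b v = v) → v = 1) (v : V) : v ^ Nat.card A = 1 := by
  classical
  have := Fintype.ofFinite A
  have := Fintype.ofFinite B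
  have trA : ∀ w : V, ∏ a : A, φ a w = 1 := by
    intro w
    apply hA
    intro a ha
    rw [map_prod]
    refine Fintype.prod_equiv (Equiv.mulLeft (⟨a, ha⟩ : A)) _ _ ?_
    intro x
    simp
  have trB : ∀ w : V, ∏ b : B, φ b w = 1 := by
    intro w
    apply hB
    intro a ha
    rw [map_prod]
    refine Fintype.prod_equiv (Equiv.mulLeft (⟨a, ha⟩ : B)) _ _ ?_
    intro x
    simp
  have h1 : ∏ a : A, ∏ b : B, φ ((a : F) * b * (a : F)⁻¹) v = 1 := by
    apply Finset.prod_eq_one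
    intro a _
    have : ∏ b : B, φ ((a : F) * b * (a : F)⁻¹) v
        = φ a (∏ b : B, φ b (φ (a : F)⁻¹ v)) := by
      rw [map_prod]
      simp
    rw [this, trB, map_one]
  rw [Finset.prod_comm, Fintype.prod_eq_single 1] at h1
  · simpa [Nat.card_eq_fintype_card] using h1
  · intro b hb
    let f : A → A := fun a => ⟨a * (b * (a : F)⁻¹ * (b : F)⁻¹),
      A.mul_mem a.2 (hBA b b.2 _ (A.inv_mem a.2))⟩
    have hf : Function.Bijective f := by
      apply Function.Injective.bijective_of_finite
      intro a a' h
      have h : (a : F) * (b * (a : F)⁻¹ * (b : F)⁻¹) = a' * (b * (a' : F)⁻¹ * (b : F)⁻¹) :=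
        congrArg Subtype.val h
      have h2 : (a' : F)⁻¹ * a = 1 := by
        refine hfree b b.2 (by simpa using hb) _ (A.mul_mem (A.inv_mem a'.2) a.2) ?_
        have h3 : (a : F) * (b * (a : F)⁻¹) = a' * (b * (a' : F)⁻¹) := by
          simpa [← mul_assoc] using h
        calc (a' : F)⁻¹ * a * b = (a' : F)⁻¹ * (a * (b * (a : F)⁻¹)) * a := by group
          _ = (a' : F)⁻¹ * (a' * (b * (a' : F)⁻¹)) * a := by rw [h3]
          _ = _ := by group
      exact Subtype.ext (inv_mul_eq_one.1 h2).symm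
    rw [← trA (φ b v)]
    refine Fintype.prod_equiv (Equiv.ofBijective f hf) _ _ ?_
    intro a
    simp only [Equiv.ofBijective_apply, f]
    rw [← MulAut.mul_apply, ← map_mul]
    congr 2
    group

lemma aux_sylow {G : Type*} [Group G] [Finite G] (M : Subgroup G) (p : ℕ) [Fact p.Prime] :
    ∃ A : Subgroup G, A ≤ M ∧ IsPGroup p A ∧
      (∀ m ∈ M, (∃ k, orderOf m = p ^ k) → ∃ g ∈ M, g * m * g⁻¹ ∈ A) ∧
      ∀ g, (∀ x, x ∈ M ↔ g * x * g⁻¹ ∈ M) →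
        ∃ m ∈ M, ∀ x, x ∈ A ↔ (m * g) * x * (m * g)⁻¹ ∈ A := by
  obtain ⟨P⟩ : Nonempty (Sylow p M) := inferInstance
  refine ⟨(P : Subgroup M).map M.subtype, ?_, P.2.map _, ?_, ?_⟩
  · exact map_subtype_le _
  · rintro m hm ⟨k, hk⟩
    have h1 : IsPGroup p (zpowers (⟨m, hm⟩ : M)) := by
      apply IsPGroup.of_card (n := k)
      rw [Nat.card_zpowers, Subgroup.orderOf_mk, hk]
    obtain ⟨Q, hQ⟩ := h1.exists_le_sylow
    obtain ⟨g, hg⟩ := MulAction.exists_smul_eq M Q P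
    refine ⟨g, g.2, g * ⟨m, hm⟩ * g⁻¹, ?_, by simp⟩
    rw [← hg]
    exact ⟨_, hQ (mem_zpowers _), rfl⟩
  · intro g hg
    let α : MulAut M := M.normalizerMonoidHom ⟨g, mem_normalizer_iff.2 hg⟩
    have hα : ∀ x, ((α x : M) : G) = g * x * g⁻¹ := fun x => rfl
    obtain ⟨m, hm⟩ := MulAction.exists_smul_eq M (α • P) P
    refine ⟨m, m.2, ?_⟩
    have key : ∀ x : M, x ∈ P ↔ m * α x * m⁻¹ ∈ P := by
      intro x
      conv_rhs => rw [← hm]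
      constructor
      · intro hx
        exact ⟨α x, ⟨x, hx, rfl⟩, rfl⟩
      · rintro ⟨z, ⟨w, hw, rfl⟩, h⟩
        have h : m * α w * m⁻¹ = m * α x * m⁻¹ := h
        have : w = x := by simpa using h
        exact this ▸ hw
    intro x
    constructor
    · rintro ⟨x, hx, rfl⟩
      exact ⟨_, (key x).1 hx, by simp [hα, mul_assoc]⟩
    · intro hx
      have hxM : x ∈ M := by
        have := map_subtype_le _ hx
        rw [hg]
        have := M.mul_mem (M.mul_mem (M.inv_mem m.2) this) m.2
        simpa [mul_assoc] using this
      refine ⟨⟨x, hxM⟩, (key _).2 ?_, rfl⟩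
      obtain ⟨z, hz, h⟩ := hx
      have hzz : m * α ⟨x, hxM⟩ * m⁻¹ = z := by
        apply Subtype.ext
        simp only [Subgroup.subtype_apply] at h
        rw [h]
        simp [hα, mul_assoc]
      rw [hzz]
      exact hz

lemma aux_fix_s13 {G : Type*} [Group G] [Finite G] (N A : Subgroup G) [N.Normal] {p q : ℕ}
    [Fact p.Prime] [Fact q.Prime] (hpq : p ≠ q) (hAp : IsPGroup p A) {c : G} (hcN : c ∈ N)
    (hcA : ∀ g ∈ zpowers c, ∀ x ∈ A, g * x * g⁻¹ ∈ A) (hc : ∃ k, orderOf c = q ^ k) {a₀ : G}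
    (ha₀ : a₀ ∈ A) : ∃ a ∈ A, a₀⁻¹ * a ∈ N ∧ Commute a c := by
  obtain ⟨k, hk⟩ := hc
  let S := {x : G // x ∈ A ∧ a₀⁻¹ * x ∈ N}
  let e : S ≃ ↥(A ⊓ N) :=
    { toFun := fun x => ⟨a₀⁻¹ * x.1, A.mul_mem (A.inv_mem ha₀) x.2.1, x.2.2⟩
      invFun := fun y => ⟨a₀ * y.1, A.mul_mem ha₀ y.2.1, by simpa using y.2.2⟩
      left_inv := fun x => by simp
      right_inv := fun x => by simp }
  have hz : ∀ g ∈ zpowers c, g ∈ N := fun g hg => (zpowers_le.2 hcN) hg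
  let act : MulAction (zpowers c) S :=
    { smul := fun g x => ⟨g * x.1 * (g : G)⁻¹, hcA g g.2 _ x.2.1, by
        have h1 : a₀⁻¹ * (g * x.1 * (g : G)⁻¹) =
          (a₀⁻¹ * g * a₀) * (a₀⁻¹ * x.1) * (g : G)⁻¹ := by group
        rw [h1]
        refine N.mul_mem (N.mul_mem ?_ x.2.2) (N.inv_mem (hz _ g.2))
        exact Normal.conj_mem' inferInstance _ (hz _ g.2) _⟩
      one_smul := fun x => Subtype.ext (by change (1 : G) * x.1 * (1 : G)⁻¹ = x.1; simp)
      mul_smul := fun g h x => Subtype.ext (by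
        change ((g : G) * h) * x.1 * ((g : G) * h)⁻¹ = g * (h * x.1 * (h : G)⁻¹) * (g : G)⁻¹
        group) }
  have hq : IsPGroup q (zpowers c) := IsPGroup.of_card (n := k) (by rw [Nat.card_zpowers, hk])
  have hnd : ¬ q ∣ Nat.card S := by
    rw [Nat.card_congr e]
    obtain ⟨n, hn⟩ := IsPGroup.iff_card.1 (hAp.to_inf_left (K := N))
    rw [hn]
    intro h
    exact hpq ((Nat.prime_dvd_prime_iff_eq Fact.out Fact.out).1
      (Nat.Prime.dvd_of_dvd_pow Fact.out h)).symm
  obtain ⟨x, hx⟩ := hq.nonempty_fixed_point_of_prime_not_dvd_card S hnd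
  refine ⟨x.1, x.2.1, x.2.2, ?_⟩
  have := congrArg Subtype.val (hx ⟨c, mem_zpowers c⟩)
  have this : c * x.1 * c⁻¹ = x.1 := this
  exact (mul_inv_eq_iff_eq_mul.1 this).symm

/-- A nontrivial `p`-subgroup normalized by a nontrivial `q`-element. -/
def HasPQ (Q : Type*) [Group Q] (p q : ℕ) : Prop :=
  ∃ X : Subgroup Q, X ≠ ⊥ ∧ IsPGroup p X ∧ ∃ y : Q, y ≠ 1 ∧ (∃ k, orderOf y = q ^ k) ∧
    ∀ x, x ∈ X ↔ y * x * y⁻¹ ∈ X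

lemma aux_dvd {p k : ℕ} {G : Type*} [Group G] {x : G} (hx : x ≠ 1) (h : orderOf x = p ^ k) :
    p ∣ orderOf x := by
  rw [h]; apply dvd_pow_self
  rintro rfl
  exact hx (orderOf_eq_one_iff.1 (by simpa using h))

lemma aux_pow {p : ℕ} (hp : p.Prime) {n : ℕ} (h : ∃ r k : ℕ, r.Prime ∧ n = r ^ k) (hd : p ∣ n) :
    ∃ k, n = p ^ k := by
  obtain ⟨r, k, hr, rfl⟩ := h
  exact ⟨k, by rw [(Nat.prime_dvd_prime_iff_eq hp hr).1 (hp.dvd_of_dvd_pow hd)]⟩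

lemma aux_main_s13 {G : Type*} [Group G] [Finite G] (N : Subgroup G) [N.Normal]
    (hppo : ∀ g : G, g ∉ N → ∃ r k : ℕ, r.Prime ∧ orderOf g = r ^ k)
    {p q r : ℕ} (hp : p.Prime) (hq : q.Prime) (hr : r.Prime) (hpq : p ≠ q) (hpr : p ≠ r)
    (hqr : q ≠ r) (hrN : r ∣ Nat.card N) (hPQ : HasPQ (G ⧸ N) p q) : False := by
  have := Fact.mk hp
  have := Fact.mk hq
  have := Fact.mk hr
  obtain ⟨X, hX, hXp, y, hy1, ⟨ky, hyo⟩, hyX⟩ := hPQ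
  let π := QuotientGroup.mk' N
  have hπ : ∀ g, π g = 1 ↔ g ∈ N := fun g => by
    rw [← MonoidHom.mem_ker, QuotientGroup.ker_mk']
  have hπs : Function.Surjective π := QuotientGroup.mk'_surjective N
  obtain ⟨R, hRN, hRr, hRel, hRF⟩ := aux_sylow N r
  have hNn : ∀ g x, x ∈ N ↔ g * x * g⁻¹ ∈ N := by
    intro g x
    constructor
    · intro h
      exact Normal.conj_mem inferInstance _ h _
    · intro h
      have := Normal.conj_mem (H := N) inferInstance _ h g⁻¹
      simpa [mul_assoc] using this
  have lift : ∀ z : G ⧸ N, ∃ n ∈ normalizer (R : Set G), π n = z := by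
    intro z
    obtain ⟨g, rfl⟩ := hπs z
    obtain ⟨m, hm, h⟩ := hRF g (hNn g)
    refine ⟨m * g, mem_normalizer_iff.2 h, ?_⟩
    rw [map_mul, (hπ m).2 hm, one_mul]
  obtain ⟨A, hAM, hAp, hAel, hAF⟩ := aux_sylow (normalizer (R : Set G) ⊓ X.comap π) p
  have hAo : ∀ a ∈ A, ∃ k, orderOf a = p ^ k := by
    intro a ha
    obtain ⟨k, hk⟩ := IsPGroup.iff_orderOf.1 hAp ⟨a, ha⟩
    exact ⟨k, by rw [← hk, Subgroup.orderOf_mk]⟩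
  have hRo : ∀ a ∈ R, ∃ k, orderOf a = r ^ k := by
    intro a ha
    obtain ⟨k, hk⟩ := IsPGroup.iff_orderOf.1 hRr ⟨a, ha⟩
    exact ⟨k, by rw [← hk, Subgroup.orderOf_mk]⟩
  -- an element of A outside N
  obtain ⟨a₀, ha₀A, ha₀N⟩ : ∃ a₀ ∈ A, a₀ ∉ N := by
    obtain ⟨x, hxX, hx1⟩ := X.bot_or_exists_ne_one.resolve_left hX
    obtain ⟨n, hn, rfl⟩ := lift x
    have hnN : n ∉ N := fun h => hx1 ((hπ n).2 h)
    have hpo : p ∣ orderOf n := by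
      obtain ⟨k, hk⟩ := IsPGroup.iff_orderOf.1 hXp ⟨_, hxX⟩
      rw [Subgroup.orderOf_mk] at hk
      exact (aux_dvd hx1 hk).trans (orderOf_map_dvd π n)
    obtain ⟨g, hg, hgA⟩ := hAel n ⟨hn, hxX⟩ (aux_pow hp (hppo n hnN) hpo)
    exact ⟨_, hgA, fun h => hnN ((hNn g n).2 h)⟩
  -- the element b
  obtain ⟨b, hbH, hbA, hbN, hbo⟩ : ∃ b ∈ normalizer (R : Set G), b ∈ normalizer (A : Set G) ∧
      b ∉ N ∧ ∃ k, orderOf b = q ^ k := by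
    obtain ⟨n, hn, hny⟩ := lift y
    obtain ⟨m, hm, h⟩ := hAF n (by
      intro x
      simp only [mem_inf, mem_comap, map_mul, map_inv, hny]
      refine and_congr ?_ (hyX _)
      constructor
      · intro h; exact mul_mem (mul_mem hn h) (inv_mem hn)
      · intro h
        have := mul_mem (mul_mem (inv_mem hn) h) hn
        simpa [mul_assoc] using this)
    have hyn : ∀ n : ℕ, ∀ x ∈ X, y ^ n * x * (y ^ n)⁻¹ ∈ X := by
      intro n
      have : y ^ n ∈ normalizer (X : Set (G ⧸ N)) := pow_mem (mem_normalizer_iff.2 hyX) _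
      intro x hx
      exact (mem_normalizer_iff.1 this x).1 hx
    have hind : ∀ n : ℕ, (π m * y) ^ n * (y ^ n)⁻¹ ∈ X := by
      intro n
      induction n with
      | zero => simp
      | succ k ih =>
        have : (π m * y) ^ (k + 1) * (y ^ (k + 1))⁻¹ =
          ((π m * y) ^ k * (y ^ k)⁻¹) * (y ^ k * π m * (y ^ k)⁻¹) := by
          rw [pow_succ, pow_succ]; group
        rw [this]
        exact mul_mem ih (hyn _ _ hm.2)
    have hq1 : q ∣ orderOf (π (m * n)) := by
      have h1 := hind (orderOf (π m * y))
      rw [pow_orderOf_eq_one, one_mul, inv_mem_iff] at h1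
      have h2 : y ^ orderOf (π m * y) = 1 := by
        have hd : Disjoint X (zpowers y) := IsPGroup.disjoint_of_ne p q hpq X _ hXp
          (IsPGroup.of_card (n := ky) (by rw [Nat.card_zpowers, hyo]))
        exact Subgroup.disjoint_def.1 hd h1 (pow_mem (mem_zpowers y) _)
      rw [map_mul, hny]
      exact (aux_dvd hy1 hyo).trans (orderOf_dvd_of_pow_eq_one h2)
    have hN : m * n ∉ N := by
      intro hh
      rw [(hπ _).2 hh, orderOf_one] at hq1
      exact hq.one_lt.ne' (Nat.dvd_one.1 hq1)
    exact ⟨m * n, mul_mem hm.1 hn, mem_normalizer_iff.2 h, hN,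
      aux_pow hq (hppo _ hN) (hq1.trans (orderOf_map_dvd π _))⟩
  have hBo : ∀ c ∈ zpowers b, ∃ k, orderOf c = q ^ k := by
    intro c hc
    obtain ⟨k, hk⟩ := hbo
    obtain ⟨j, -, hj⟩ := (Nat.dvd_prime_pow hq).1 (hk ▸ orderOf_dvd_of_mem_zpowers hc)
    exact ⟨j, hj⟩
  have hBA : ∀ c ∈ zpowers b, ∀ x ∈ A, c * x * c⁻¹ ∈ A := by
    intro c hc x hx
    exact (mem_normalizer_iff.1 ((zpowers_le.2 hbA) hc) x).1 hx
  have hBN : ∀ c ∈ zpowers b, c ≠ 1 → c ∉ N := by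
    intro c hc hc1 hcN
    obtain ⟨a, haA, haN, hac⟩ := aux_fix_s13 N A hpq hAp hcN
      (fun g hg => hBA g ((zpowers_le.2 hc) hg)) (hBo c hc) ha₀A
    have haN' : a ∉ N := by
      intro h
      apply ha₀N
      have := N.mul_mem h (N.inv_mem haN)
      simpa using this
    exact hc1 (aux_comm N hppo hp hq hpq haN' (hAo a haA) (hBo c hc) hac)
  -- the abelian group V
  let V : Subgroup G := R ⊓ centralizer (R : Set G)
  have hVcomm : ∀ u v : V, u * v = v * u := by
    intro u v
    exact Subtype.ext (mem_centralizer_iff.1 v.2.2 _ u.2.1)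
  let iV : CommGroup V := { (inferInstance : Group V) with mul_comm := hVcomm }
  have hHV : normalizer (R : Set G) ≤ normalizer (V : Set G) := by
    have h1 : ∀ g ∈ normalizer (R : Set G), ∀ v ∈ V, g * v * g⁻¹ ∈ V := by
      intro g hg v hv
      refine ⟨(mem_normalizer_iff.1 hg v).1 hv.1, ?_⟩
      apply mem_centralizer_iff.2
      intro z hz
      have h2 := mem_centralizer_iff.1 hv.2 (g⁻¹ * z * g)
        ((mem_normalizer_iff''.1 hg z).1 hz)
      calc z * (g * v * g⁻¹) = g * ((g⁻¹ * z * g) * v) * g⁻¹ := by group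
        _ = g * (v * (g⁻¹ * z * g)) * g⁻¹ := by rw [h2]
        _ = _ := by group
    intro g hg
    refine mem_normalizer_iff.2 fun v => ⟨h1 g hg v, fun h => ?_⟩
    have := h1 g⁻¹ (inv_mem hg) _ h
    simpa [mul_assoc] using this
  have hAV : A ≤ normalizer (V : Set G) := fun a ha => hHV (hAM ha).1
  have hBV : zpowers b ≤ normalizer (V : Set G) := zpowers_le.2 (hHV hbH)
  have hfix : ∀ (g : normalizer (V : Set G)) (v : V), V.normalizerMonoidHom g v = v →
      Commute (g : G) (v : G) := by
    intro g v h
    have h : (g : G) * v * (g : G)⁻¹ = v := congrArg Subtype.val h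
    exact mul_inv_eq_iff_eq_mul.1 h
  have key := aux_frob (V.normalizerMonoidHom) (A.subgroupOf (normalizer (V : Set G)))
    ((zpowers b).subgroupOf (normalizer (V : Set G)))
    (fun c hc a ha => hBA c hc a ha)
    (fun c hc hc1 a ha hac => by
      have hc1' : (c : G) ≠ 1 := by simpa using hc1
      have : (a : G) = 1 := aux_comm N hppo hq hp hpq.symm (hBN c hc hc1') (hBo c hc) (hAo a ha)
        (congrArg Subtype.val hac).symm
      exact Subtype.ext this)
    (fun v hv => by
      have h1 := hfix _ v (hv ⟨a₀, hAV ha₀A⟩ ha₀A)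
      exact Subtype.ext (aux_comm N hppo hp hr hpr ha₀N (hAo _ ha₀A) (hRo _ v.2.1) h1))
    (fun v hv => by
      have h1 := hfix _ v (hv ⟨b, hBV (mem_zpowers b)⟩ (mem_zpowers b))
      exact Subtype.ext (aux_comm N hppo hq hr hqr hbN hbo (hRo _ v.2.1) h1))
  -- V is nontrivial
  have hRnt : Nontrivial R := by
    obtain ⟨x, hx⟩ := exists_prime_orderOf_dvd_card' r hrN
    have hx' : orderOf (x : G) = r := by rw [Subgroup.orderOf_coe, hx]
    obtain ⟨g, hg, hgx⟩ := hRel x x.2 ⟨1, by rw [hx', pow_one]⟩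
    refine ⟨⟨⟨_, hgx⟩, 1, fun h => ?_⟩⟩
    have h : g * x * g⁻¹ = 1 := congrArg Subtype.val h
    rw [conj_eq_one_iff] at h
    rw [h, orderOf_one] at hx'
    exact hr.one_lt.ne hx'
  have := hRr.center_nontrivial
  obtain ⟨v, hv⟩ := exists_ne (1 : center R)
  have hvV : ((v : R) : G) ∈ V := by
    refine ⟨v.1.2, mem_centralizer_iff.2 fun z hz => ?_⟩
    exact congrArg Subtype.val (mem_center_iff.1 v.2 ⟨z, hz⟩)
  have hv1 : ((v : R) : G) ≠ 1 := by
    intro h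
    exact hv (Subtype.ext (Subtype.ext h))
  have h1 : ((v : R) : G) ^ Nat.card (A.subgroupOf (normalizer (V : Set G))) = 1 :=
    congrArg Subtype.val (key ⟨_, hvV⟩)
  obtain ⟨k, hk⟩ := hRo _ v.1.2
  have h2 : r ∣ Nat.card (A.subgroupOf (normalizer (V : Set G))) :=
    (aux_dvd hv1 hk).trans (orderOf_dvd_of_pow_eq_one h1)
  obtain ⟨n, hn⟩ := IsPGroup.iff_card.1 (hAp.comap_subtype (K := normalizer (V : Set G)))
  have hn' : Nat.card (A.subgroupOf (normalizer (V : Set G))) = p ^ n := hn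
  rw [hn'] at h2
  exact hpr ((Nat.prime_dvd_prime_iff_eq hr hp).1 (hr.dvd_of_dvd_pow h2)).symm

lemma HasPQ.of_subgroup {Q : Type*} [Group Q] (K : Subgroup Q) {p q : ℕ} (h : HasPQ K p q) :
    HasPQ Q p q := by
  obtain ⟨X, hX, hXp, y, hy1, hyo, hyX⟩ := h
  refine ⟨X.map K.subtype, ?_, hXp.map _, y, ?_, ?_, ?_⟩
  · rw [Ne, (map_eq_bot_iff_of_injective _ K.subtype_injective)]
    exact hX
  · simpa using hy1
  · simpa using hyo
  · intro x
    constructor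
    · rintro ⟨x, hx, rfl⟩
      exact ⟨_, (hyX x).1 hx, rfl⟩
    · rintro ⟨z, hz, h⟩
      refine ⟨y⁻¹ * z * y, (hyX _).2 ?_, ?_⟩
      · simpa [mul_assoc] using hz
      · have h : (z : Q) = y * x * (y : Q)⁻¹ := h
        simp [h, mul_assoc]

lemma aux_not_pgroup {G : Type*} [Group G] [Finite G] {t : ℕ} (ht : t.Prime)
    (h : ¬ IsPGroup t G) : ∃ u, u.Prime ∧ u ≠ t ∧ u ∣ Nat.card G := by
  rw [isPGroup_iff_primeFactors_card_subset ht.ne_zero, Finset.not_subset] at h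
  obtain ⟨u, hu, hut⟩ := h
  have := Nat.mem_primeFactors.1 hu
  refine ⟨u, this.1, ?_, this.2.1⟩
  rintro rfl
  exact hut (by simp [ht])

lemma aux_unique {Q : Type*} [Group Q] [Finite Q] {t : ℕ} [Fact t.Prime]
    (h1 : ∀ X : Subgroup Q, X ≠ ⊥ → IsPGroup t X → IsPGroup t (normalizer (X : Set Q))) :
    ∀ n : ℕ, ∀ D : Subgroup Q, D ≠ ⊥ → Nat.card Q - Nat.card D = n →
      ∀ S T : Sylow t Q, D ≤ S → D ≤ T → S = T := by
  intro n
  induction n using Nat.strong_induction_on with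
  | _ n ih =>
    intro D hD hn S T hDS hDT
    have hDt : IsPGroup t D := S.2.to_le hDS
    obtain ⟨W, hW⟩ := (h1 D hD hDt).exists_le_sylow
    have key : ∀ S : Sylow t Q, D ≤ S → S = W := by
      intro S hDS
      by_cases hEq : (S : Subgroup Q) ≤ D
      · have : D = S := le_antisymm hDS hEq
        have h2 : (S : Subgroup Q) ≤ W := by
          rw [← this]
          exact le_normalizer.trans hW
        exact Sylow.ext (S.3 W.2 h2).symm
      · have hnil : Group.IsNilpotent S := S.2.isNilpotent
        have hlt : D.subgroupOf S < ⊤ := by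
          rw [lt_top_iff_ne_top, Ne, subgroupOf_eq_top]
          exact hEq
        obtain ⟨x, hx, hxD⟩ := SetLike.exists_of_lt
          (Group.normalizerCondition_of_isNilpotent (G := S) _ hlt)
        have hxN : (x : Q) ∈ normalizer (D : Set Q) := by
          rw [mem_normalizer_iff] at hx ⊢
          intro d
          constructor
          · intro hd
            exact (hx ⟨d, hDS hd⟩).1 hd
          · intro hd
            have hdS : d ∈ (S : Subgroup Q) := by
              have := mul_mem (mul_mem (inv_mem x.2) (hDS hd)) x.2
              simpa [mul_assoc] using this
            exact (hx ⟨d, hdS⟩).2 hd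
        have hDE : D < normalizer (D : Set Q) ⊓ S := by
          refine lt_of_le_of_ne (le_inf le_normalizer hDS) ?_
          intro h
          apply hxD
          change (x : Q) ∈ D
          rw [h]
          exact ⟨hxN, x.2⟩
        have hcard : Nat.card D < Nat.card ↥(normalizer (D : Set Q) ⊓ S) :=
          Set.ncard_lt_ncard hDE (Set.toFinite _)
        have hcard2 : Nat.card ↥(normalizer (D : Set Q) ⊓ S) ≤ Nat.card Q :=
          Subgroup.card_le_card_group _
        exact ih _ (by omega) _ (ne_bot_of_gt hDE) rfl S W inf_le_right
          (inf_le_left.trans hW)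
    rw [key S hDS, key T hDT]

open scoped commutatorElement in
lemma aux_pair {t : ℕ} [Fact t.Prime] : ∀ n : ℕ, ∀ (Q : Type*) [Group Q] [Finite Q],
    Nat.card Q = n → t ∣ Nat.card Q → ¬ IsPGroup t Q →
    ∃ u, u.Prime ∧ u ≠ t ∧ (HasPQ Q t u ∨ HasPQ Q u t) := by
  have ht : t.Prime := Fact.out
  intro n
  induction n using Nat.strong_induction_on with
  | _ n ih =>
    intro Q _ _ hn htQ hnt
    by_contra hcon
    push Not at hcon
    have h1 : ∀ X : Subgroup Q, X ≠ ⊥ → IsPGroup t X →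
        IsPGroup t (normalizer (X : Set Q)) := by
      intro X hX hXt
      by_contra hno
      obtain ⟨u, hu, hut, hud⟩ := aux_not_pgroup ht hno
      have := Fact.mk hu
      obtain ⟨y, hy⟩ := exists_prime_orderOf_dvd_card' u hud
      refine (hcon u hu hut).1 ⟨X, hX, hXt, y, ?_, ⟨1, by simp [hy]⟩, mem_normalizer_iff.1 y.2⟩
      intro h
      have : y = 1 := Subtype.ext h
      rw [this, orderOf_one] at hy
      exact hu.one_lt.ne hy
    obtain ⟨T⟩ : Nonempty (Sylow t Q) := inferInstance
    have hTb : (T : Subgroup Q) ≠ ⊥ := T.ne_bot_of_dvd_card htQ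
    have hNT : normalizer (T : Set Q) ≤ (T : Subgroup Q) :=
      (T.3 (h1 T hTb T.2) le_normalizer).le
    have h3 : ∀ x ∈ T, x ≠ 1 → ∀ g, g * x * g⁻¹ ∈ T → g ∈ T := by
      intro x hx hx1 g hg
      apply hNT
      have h := aux_unique h1 _ (zpowers (g * x * g⁻¹))
        (by rw [Ne, zpowers_eq_bot, conj_eq_one_iff]; exact hx1) rfl (g • T) T
        (zpowers_le.2 ⟨x, hx, rfl⟩) (zpowers_le.2 hg)
      exact Sylow.smul_eq_iff_mem_normalizer.1 h
    have hfoc : focalSubgroupOf (T : Subgroup Q) ≤ commutator T := by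
      rw [focalSubgroupOf_eq_closure, closure_le]
      rintro g ⟨x, hx, u, hg⟩
      rw [commutatorElement_def] at hg
      by_cases hx1 : x = 1
      · have : g = 1 := Subtype.ext (by rw [hg, hx1]; simp)
        rw [this]
        exact one_mem _
      · have hu : u ∈ (T : Subgroup Q) := by
          apply h3 x⁻¹ (inv_mem hx) (by simpa using hx1)
          change _ ∈ (T : Subgroup Q)
          have := mul_mem (inv_mem hx) g.2
          rw [hg] at this
          simpa [mul_assoc] using this
        have : g = ⁅(⟨x, hx⟩ : (T : Subgroup Q)), (⟨u, hu⟩ : (T : Subgroup Q))⁆ := Subtype.ext (by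
          rw [hg]; rfl)
        rw [this]
        exact commutator_mem_commutator (mem_top _) (mem_top _)
    have hTnt : Nontrivial T := (nontrivial_iff_ne_bot _).2 hTb
    have hnil : Group.IsNilpotent T := T.2.isNilpotent
    have hcl : commutator T < ⊤ := Group.IsSolvable.commutator_lt_top_of_nontrivial T
    let K := (transferFocal (T : Subgroup Q)).ker
    have hKT : K ≠ ⊤ := by
      intro hK
      have h2 := ker_transferFocal_inf_eq_focalSubgroup T
      change K ⊓ T = _ at h2
      rw [hK, top_inf_eq] at h2
      apply hcl.not_ge
      refine le_trans ?_ hfoc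
      intro x _
      rw [focalSubgroupOf_def, mem_subgroupOf, ← h2]
      exact x.2
    have hKnt : ¬ IsPGroup t K := by
      intro hK
      apply hnt
      have h2 : IsPGroup t (T ⧸ focalSubgroupOf (T : Subgroup Q)) := T.2.to_quotient _
      have h4 := (h2.to_subgroup ⊤).comap_of_ker_isPGroup (transferFocal (T : Subgroup Q)) hK
      rw [comap_top] at h4
      exact h4.of_equiv topEquiv
    by_cases htK : t ∣ Nat.card K
    · have hlt : Nat.card K < n := by
        rw [← hn]
        exact lt_of_le_of_ne (Subgroup.card_le_card_group _) fun h => hKT (K.eq_top_of_card_eq h)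
      obtain ⟨u, hu, hut, h⟩ := ih _ hlt K rfl htK hKnt
      rcases h with h | h
      · exact (hcon u hu hut).1 h.of_subgroup
      · exact (hcon u hu hut).2 h.of_subgroup
    · obtain ⟨u, hu, hut, hud⟩ := aux_not_pgroup ht hKnt
      have := Fact.mk hu
      obtain ⟨U, hUK, hUp, hUel, hUF⟩ := aux_sylow K u
      obtain ⟨g, hg⟩ := exists_prime_orderOf_dvd_card' t htQ
      have hKn : ∀ g x, x ∈ K ↔ g * x * g⁻¹ ∈ K := by
        intro g x
        constructor
        · intro h
          exact Normal.conj_mem inferInstance _ h _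
        · intro h
          have := Normal.conj_mem (H := K) inferInstance _ h g⁻¹
          simpa [mul_assoc] using this
      obtain ⟨m, hm, hU⟩ := hUF g (hKn g)
      have hgK : g ∉ K := by
        intro h
        apply htK
        rw [← hg, ← Subgroup.orderOf_mk g h]
        exact orderOf_dvd_natCard _
      have hto : t ∣ orderOf (m * g) := by
        have h2 : orderOf (QuotientGroup.mk' K g) = t := by
          apply orderOf_eq_prime
          · have hgt : g ^ t = 1 := orderOf_dvd_iff_pow_eq_one.1 hg.dvd
            rw [← map_pow, hgt, map_one]
          · intro h
            rw [← MonoidHom.mem_ker, QuotientGroup.ker_mk'] at h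
            exact hgK h
        have h3 : QuotientGroup.mk' K (m * g) = QuotientGroup.mk' K g := by
          have : QuotientGroup.mk' K m = 1 := by
            rw [← MonoidHom.mem_ker, QuotientGroup.ker_mk']
            exact hm
          rw [map_mul, this, one_mul]
        rw [← h2, ← h3]
        exact orderOf_map_dvd _ _
      have hyo : orderOf ((m * g) ^ (orderOf (m * g) / t)) = t :=
        orderOf_pow_orderOf_div (orderOf_pos _).ne' hto
      refine (hcon u hu hut).2 ⟨U, ?_, hUp, (m * g) ^ (orderOf (m * g) / t), ?_,
        ⟨1, by rw [hyo, pow_one]⟩, ?_⟩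
      · rintro rfl
        obtain ⟨x, hx⟩ := exists_prime_orderOf_dvd_card' u hud
        have hx' : orderOf (x : Q) = u := by rw [Subgroup.orderOf_coe, hx]
        obtain ⟨w, hw, hwx⟩ := hUel x x.2 ⟨1, by rw [hx', pow_one]⟩
        rw [mem_bot, conj_eq_one_iff] at hwx
        rw [hwx, orderOf_one] at hx'
        exact hu.one_lt.ne hx'
      · intro h
        rw [h, orderOf_one] at hyo
        exact ht.one_lt.ne hyo
      · exact mem_normalizer_iff.1 (pow_mem (mem_normalizer_iff.2 hU) _)

theorem stmt_13 {G : Type*} [Group G] [Fintype G] (N : Subgroup G) [N.Normal]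
    (hppo : ∀ g : G, g ∉ N → ∃ r k : ℕ, r.Prime ∧ orderOf g = r ^ k)
    (h3 : ∃ p q r : ℕ, p.Prime ∧ q.Prime ∧ r.Prime ∧ p ≠ q ∧ p ≠ r ∧ q ≠ r ∧
      (∃ g : G, g ∉ N ∧ p ∣ orderOf g) ∧
      (∃ g : G, g ∉ N ∧ q ∣ orderOf g) ∧
      (∃ g : G, g ∉ N ∧ r ∣ orderOf g)) :
    ∀ g : G, ∃ r k : ℕ, r.Prime ∧ orderOf g = r ^ k := by
  intro g
  by_cases hgN : g ∉ N
  · exact hppo g hgN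
  rw [not_not] at hgN
  by_contra hcon
  have hg1 : orderOf g ≠ 1 := fun h => hcon ⟨2, 0, Nat.prime_two, by simpa using h⟩
  obtain ⟨r, hr, hrg⟩ := Nat.exists_prime_and_dvd hg1
  obtain ⟨s, hs, hsr, hsg⟩ : ∃ s, s.Prime ∧ s ≠ r ∧ s ∣ orderOf g := by
    rw [← Nat.card_zpowers]
    apply aux_not_pgroup hr
    intro h
    have := Fact.mk hr
    obtain ⟨k, hk⟩ := IsPGroup.iff_card.1 h
    exact hcon ⟨r, k, hr, by rw [← Nat.card_zpowers, hk]⟩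
  have hoN : orderOf g ∣ Nat.card N := by
    rw [← Subgroup.orderOf_mk g hgN]
    exact orderOf_dvd_natCard _
  have hdQ : ∀ t, t.Prime → (∃ g : G, g ∉ N ∧ t ∣ orderOf g) → t ∣ Nat.card (G ⧸ N) := by
    rintro t ht ⟨x, hxN, htx⟩
    obtain ⟨k, hk⟩ := aux_pow ht (hppo x hxN) htx
    have h1 : QuotientGroup.mk' N x ≠ 1 := by
      intro h
      rw [← MonoidHom.mem_ker, QuotientGroup.ker_mk'] at h
      exact hxN h
    obtain ⟨j, -, hj⟩ := (Nat.dvd_prime_pow ht).1 (hk ▸ orderOf_map_dvd (QuotientGroup.mk' N) x)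
    exact (aux_dvd h1 hj).trans (orderOf_dvd_natCard _)
  obtain ⟨t, w, ht, hw, htr, hts, hwt, htQ, hwQ⟩ : ∃ t w : ℕ, t.Prime ∧ w.Prime ∧ t ≠ r ∧ t ≠ s ∧
      w ≠ t ∧ t ∣ Nat.card (G ⧸ N) ∧ w ∣ Nat.card (G ⧸ N) := by
    obtain ⟨a, b, c, ha, hb, hc, hab, hac, hbc, h1, h2, h3⟩ := h3
    have h1 := hdQ a ha h1
    have h2 := hdQ b hb h2
    have h3 := hdQ c hc h3
    by_cases hA : a ≠ r ∧ a ≠ s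
    · exact ⟨a, b, ha, hb, hA.1, hA.2, hab.symm, h1, h2⟩
    by_cases hB : b ≠ r ∧ b ≠ s
    · exact ⟨b, a, hb, ha, hB.1, hB.2, hab, h2, h1⟩
    · exact ⟨c, a, hc, ha, by omega, by omega, hac, h3, h1⟩
  have := Fact.mk ht
  have hQt : ¬ IsPGroup t (G ⧸ N) := by
    intro h
    obtain ⟨k, hk⟩ := IsPGroup.iff_card.1 h
    rw [hk] at hwQ
    exact hwt ((Nat.prime_dvd_prime_iff_eq hw ht).1 (hw.dvd_of_dvd_pow hwQ))
  obtain ⟨u, hu, hut, hP⟩ := aux_pair (t := t) _ (G ⧸ N) rfl htQ hQt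
  obtain ⟨v, hv, hvt, hvu, hvN⟩ : ∃ v : ℕ, v.Prime ∧ t ≠ v ∧ u ≠ v ∧ v ∣ Nat.card N := by
    by_cases h : u = r
    · exact ⟨s, hs, hts, by omega, hsg.trans hoN⟩
    · exact ⟨r, hr, htr, h, hrg.trans hoN⟩
  rcases hP with hP | hP
  · exact aux_main_s13 N hppo ht hu hv hut.symm hvt hvu hvN hP
  · exact aux_main_s13 N hppo hu ht hv hut hvu hvt hvN hP
end
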